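/- arXiv:1410.2927 — 8 statements merged into one kernel-verified Lean document; each statement's English description precedes it below -/
import Mathlib

section
/- Let θ be a real number with θ > 1 and let n be a positive integer with n > log θ / log 2. Then either M_θ(n) = ⌊n/log θ − 1/2⌋ (and then n ∉ A_θ), or M_θ(n) = ⌊n/log θ + 1/2⌋ (and then n ∈ A_θ); in particular M_θ(n) always equals one of these two values, and it equals ⌊n/log θ + 1/2⌋ exactly when n ∈ A_θ. -/
/-- `M_θ(n) = ⌊1/{θ^{1/n}}⌋` where `{·}` is the fractional part. -/
noncomputable def Mtheta (θ : ℝ) (n : ℕ) : ℤ := ⌊(Int.fract (θ ^ ((n : ℝ))⁻¹))⁻¹⌋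

/-- The set of atypical numbers `A_θ`, defined via `M'_θ(n) = ⌊1/(θ^{1/n} - 1)⌋`. -/
noncomputable def Atheta (θ : ℝ) : Set ℕ :=
  {n | 0 < n ∧ ⌊(θ ^ ((n : ℝ))⁻¹ - 1)⁻¹⌋ ≠ ⌊(n : ℝ) / Real.log θ - 1 / 2⌋}

theorem exp_mul_two_sub_le {x : ℝ} (h0 : 0 ≤ x) (h1 : x ≤ 1) :
    Real.exp x * (2 - x) ≤ 2 + x := by
  have h := Real.exp_bound' h0 h1 (n := 3) (by norm_num)
  norm_num [Finset.sum_range_succ, Nat.factorial] at h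
  have h3 : 0 ≤ x ^ 3 := pow_nonneg h0 3
  have h4 : 0 ≤ x ^ 4 := pow_nonneg h0 4
  have := mul_le_mul_of_nonneg_right h (by linarith : (0 : ℝ) ≤ 2 - x)
  nlinarith

theorem inv_sub_half_le_inv_exp_sub_one {x : ℝ} (h0 : 0 < x) (h1 : x ≤ 1) :
    x⁻¹ - 1 / 2 ≤ (Real.exp x - 1)⁻¹ := by
  have hx : 0 < Real.exp x - 1 := by linarith [Real.add_one_le_exp x]
  have h := exp_mul_two_sub_le h0.le h1
  have e : x⁻¹ - 1 / 2 = (2 - x) / (2 * x) := by field_simp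
  rw [e, ← one_div, div_le_div_iff₀ (by positivity) hx]
  nlinarith

theorem inv_exp_sub_one_le_inv {x : ℝ} (h0 : 0 < x) : (Real.exp x - 1)⁻¹ ≤ x⁻¹ :=
  inv_anti₀ h0 (by linarith [Real.add_one_le_exp x])

theorem stmt0 (θ : ℝ) (hθ : 1 < θ) (n : ℕ) (hn : 0 < n)
    (hbig : Real.log θ / Real.log 2 < (n : ℝ)) :
    ((Mtheta θ n = ⌊(n : ℝ) / Real.log θ - 1 / 2⌋ ∧ n ∉ Atheta θ) ∨
      (Mtheta θ n = ⌊(n : ℝ) / Real.log θ + 1 / 2⌋ ∧ n ∈ Atheta θ)) ∧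
    (Mtheta θ n = ⌊(n : ℝ) / Real.log θ + 1 / 2⌋ ↔ n ∈ Atheta θ) := by
  have hn' : (0 : ℝ) < n := by exact_mod_cast hn
  have hlog : 0 < Real.log θ := Real.log_pos hθ
  have hl2 : 0 < Real.log 2 := Real.log_pos one_lt_two
  obtain ⟨x, hx⟩ : ∃ x, x = Real.log θ / n := ⟨_, rfl⟩
  have hx0 : 0 < x := hx ▸ div_pos hlog hn'
  have hx2 : x < Real.log 2 := by
    rw [hx, div_lt_iff₀ hn']
    rwa [div_lt_iff₀ hl2, mul_comm] at hbig
  have hx1 : x ≤ 1 := by linarith [Real.log_two_lt_d9]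
  have hpow : θ ^ ((n : ℝ))⁻¹ = Real.exp x := by
    rw [Real.rpow_def_of_pos (by linarith), hx, div_eq_mul_inv]
  have hinv : (n : ℝ) / Real.log θ = x⁻¹ := by rw [hx, inv_div]
  have hfract : Int.fract (Real.exp x) = Real.exp x - 1 := by
    have hlt : Real.exp x < 2 := by
      simpa [Real.exp_log] using Real.exp_lt_exp.2 hx2
    rw [Int.fract_eq_iff]
    exact ⟨by linarith [Real.add_one_le_exp x], by linarith, 1, by simp⟩
  have hsucc : ⌊x⁻¹ + 1 / 2⌋ = ⌊x⁻¹ - 1 / 2⌋ + 1 := by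
    rw [← Int.floor_add_one]
    ring_nf
  have hlow : ⌊x⁻¹ - 1 / 2⌋ ≤ ⌊(Real.exp x - 1)⁻¹⌋ :=
    Int.floor_mono (inv_sub_half_le_inv_exp_sub_one hx0 hx1)
  have hupp : ⌊(Real.exp x - 1)⁻¹⌋ ≤ ⌊x⁻¹ + 1 / 2⌋ :=
    Int.floor_mono (by linarith [inv_exp_sub_one_le_inv hx0])
  simp only [Mtheta, Atheta, Set.mem_ofPred_eq, hpow, hinv, hfract, hn, true_and]
  omega
end

section
/- Let p and q be positive integers with p/q > 1, and let θ = e^{p/q}, so log θ = p/q. Then every n ∈ A_θ satisfies n < p²/(6q); that is, A_θ ⊆ [1, p²/(6q)). -/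
/-- A function vanishing at `0` with positive derivative on `(0, ∞)` is positive there. -/
theorem pos_of_hasDerivAt_pos {f f' : ℝ → ℝ} (h0 : f 0 = 0)
    (hf : ∀ x, HasDerivAt f (f' x) x) (hf' : ∀ x, 0 < x → 0 < f' x) {x : ℝ} (hx : 0 < x) :
    0 < f x := by
  have hmono : StrictMonoOn f (Set.Ici 0) := by
    refine strictMonoOn_of_deriv_pos (convex_Ici 0)
      (fun y _ => (hf y).continuousAt.continuousWithinAt) fun y hy => ?_
    rw [interior_Ici] at hy
    rw [(hf y).deriv]
    exact hf' y hy
  simpa [h0] using hmono Set.self_mem_Ici hx.le hx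

theorem two_sub_mul_exp_sub_one_lt {x : ℝ} (hx : 0 < x) :
    (2 - x) * (Real.exp x - 1) < 2 * x := by
  have h := pos_of_hasDerivAt_pos (f := fun x => 2 * x - (2 - x) * (Real.exp x - 1))
    (f' := fun x => 1 + Real.exp x * (x - 1)) (by simp) (fun y => ?_) (fun y hy => ?_) hx
  · linarith
  · have := ((hasDerivAt_id y).const_mul 2).sub
      (((hasDerivAt_id y).const_sub 2).mul ((Real.hasDerivAt_exp y).sub_const 1))
    exact this.congr_deriv (by simp only [id]; ring)
  · have h1 := Real.add_one_lt_exp (neg_ne_zero.mpr hy.ne')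
    have h2 : Real.exp y * Real.exp (-y) = 1 := by rw [← Real.exp_add]; simp
    nlinarith [Real.exp_pos y]

theorem twelve_mul_lt_exp_sub_one_mul {x : ℝ} (hx : 0 < x) :
    12 * x < (Real.exp x - 1) * (x ^ 2 - 6 * x + 12) := by
  have hquad (b c y : ℝ) : HasDerivAt (fun x : ℝ => x ^ 2 - b * x + c) (2 * y - b) y := by
    have := (((hasDerivAt_id y).pow 2).sub ((hasDerivAt_id y).const_mul b)).add_const c
    exact this.congr_deriv (by simp)
  have h2 : ∀ x : ℝ, 0 < x → 0 < Real.exp x * (x ^ 2 - 2 * x + 2) - 2 := by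
    intro x hx
    refine pos_of_hasDerivAt_pos (f := fun x => Real.exp x * (x ^ 2 - 2 * x + 2) - 2)
      (f' := fun x => Real.exp x * x ^ 2) (by simp) (fun y => ?_) (fun y hy => by positivity) hx
    exact (((Real.hasDerivAt_exp y).mul (hquad 2 2 y)).sub_const 2).congr_deriv (by ring)
  have h1 : ∀ x : ℝ, 0 < x → 0 < Real.exp x * (x ^ 2 - 4 * x + 6) - (2 * x + 6) := by
    intro x hx
    refine pos_of_hasDerivAt_pos (f := fun x => Real.exp x * (x ^ 2 - 4 * x + 6) - (2 * x + 6))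
      (by simp) (fun y => ?_) h2 hx
    exact (((Real.hasDerivAt_exp y).mul (hquad 4 6 y)).sub
      (((hasDerivAt_id y).const_mul 2).add_const 6)).congr_deriv (by ring)
  have h := pos_of_hasDerivAt_pos
    (f := fun x => (Real.exp x - 1) * (x ^ 2 - 6 * x + 12) - 12 * x)
    (by simp) (fun y => ?_) h1 hx
  · linarith
  · exact ((((Real.hasDerivAt_exp y).sub_const 1).mul (hquad 6 12 y)).sub
      ((hasDerivAt_id y).const_mul 12)).congr_deriv (by ring)

theorem inv_sub_half_lt_inv_exp_sub_one {x : ℝ} (hx : 0 < x) :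
    x⁻¹ - 1 / 2 < (Real.exp x - 1)⁻¹ := by
  have he : 0 < Real.exp x - 1 := by linarith [Real.add_one_lt_exp hx.ne']
  have h : x⁻¹ - 1 / 2 = (2 - x) / (2 * x) := by field_simp
  rw [h, inv_eq_one_div, div_lt_div_iff₀ (by positivity) he, one_mul]
  exact two_sub_mul_exp_sub_one_lt hx

theorem inv_exp_sub_one_lt {x : ℝ} (hx : 0 < x) :
    (Real.exp x - 1)⁻¹ < x⁻¹ - 1 / 2 + x / 12 := by
  have he : 0 < Real.exp x - 1 := by linarith [Real.add_one_lt_exp hx.ne']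
  have h : x⁻¹ - 1 / 2 + x / 12 = (x ^ 2 - 6 * x + 12) / (12 * x) := by field_simp; ring
  rw [h, inv_eq_one_div, div_lt_div_iff₀ he (by positivity), one_mul]
  linarith [twelve_mul_lt_exp_sub_one_mul hx]

theorem stmt1 (p q : ℕ) (hp : 0 < p) (hq : 0 < q) (hpq : 1 < (p : ℝ) / q)
    (θ : ℝ) (hθ : θ = Real.exp ((p : ℝ) / q)) :
    ∀ n ∈ Atheta θ, (n : ℝ) < (p : ℝ) ^ 2 / (6 * q) := by
  rintro n ⟨hn, hne⟩
  have hp' : (0 : ℝ) < p := by exact_mod_cast hp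
  have hq' : (0 : ℝ) < q := by exact_mod_cast hq
  have hn' : (0 : ℝ) < n := by exact_mod_cast hn
  set x : ℝ := (p : ℝ) / q * (n : ℝ)⁻¹ with hxdef
  have hx : 0 < x := by positivity
  have hxinv : (n : ℝ) / (p / q) = x⁻¹ := by rw [hxdef]; field_simp
  rw [hθ, Real.log_exp, ← Real.exp_mul, ← hxdef, hxinv] at hne
  have hlow := inv_sub_half_lt_inv_exp_sub_one hx
  have hup := inv_exp_sub_one_lt hx
  set m : ℤ := ⌊(Real.exp x - 1)⁻¹⌋ with hm
  have hlt : x⁻¹ - 1 / 2 < m := by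
    rw [← Int.floor_lt]
    exact lt_of_le_of_ne (Int.floor_le_floor hlow.le) hne.symm
  have hmle : (m : ℝ) < x⁻¹ - 1 / 2 + x / 12 := (Int.floor_le _).trans_lt hup
  have hxinv' : x⁻¹ = n * q / p := by rw [← hxinv]; field_simp
  have hint : (2 * n * q - p : ℤ) < 2 * p * m := by
    have h : (2 * n * q - p : ℝ) < 2 * p * m := by
      have h := mul_lt_mul_of_pos_left hlt (by positivity : (0 : ℝ) < 2 * p)
      rw [hxinv'] at h
      calc (2 * n * q - p : ℝ) = 2 * p * (n * q / p - 1 / 2) := by field_simp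
        _ < _ := h
    exact_mod_cast h
  have hstep : (2 * n * q - p + 1 : ℝ) ≤ 2 * p * m := by exact_mod_cast hint
  have hgap : 1 < 2 * p * (x / 12) := by
    have h := mul_lt_mul_of_pos_left hmle (by positivity : (0 : ℝ) < 2 * p)
    have h' : 2 * p * (x⁻¹ - 1 / 2 + x / 12) = 2 * n * q - p + 2 * p * (x / 12) := by
      rw [hxinv']; field_simp
    linarith
  have hx' : 2 * p * (x / 12) = (p : ℝ) ^ 2 / (6 * q) / n := by
    rw [hxdef]; field_simp; norm_num
  rwa [hx', one_lt_div hn'] at hgap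
end

section
/- For Lebesgue-almost all real numbers θ > 1, the counting function of A_θ satisfies |A_θ ∩ [1, n]| ∼ (log θ / 12) · log n as n → ∞; that is, the set of θ > 1 for which |A_θ ∩ [1, n]| / log n → log θ / 12 has full Lebesgue measure in (1, ∞). -/
/-- The overlap of the intervals `(s, s + a]` and `(0, b]` for `s ≥ 0` is `clampLen a (b - s)`. -/
noncomputable def clampLen (a v : ℝ) : ℝ := max 0 (min a v)

/-- A primitive of `clampLen a`. -/
noncomputable def clampPrim (a v : ℝ) : ℝ := ((max v 0) ^ 2 - (max (v - a) 0) ^ 2) / 2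

lemma clampLen_nonneg (a v : ℝ) : 0 ≤ clampLen a v := le_max_left _ _

lemma clampPrim_nonneg {a : ℝ} (ha : 0 ≤ a) (v : ℝ) : 0 ≤ clampPrim a v := by
  unfold clampPrim
  have h1 : max (v - a) 0 ≤ max v 0 := max_le_max (by linarith) le_rfl
  have h2 : 0 ≤ max (v - a) 0 := le_max_right _ _
  nlinarith

lemma clampPrim_add_swap {a b : ℝ} (ha : 0 ≤ a) (hb : 0 ≤ b) :
    clampPrim a b + clampPrim b a = a * b := by
  unfold clampPrim
  rw [max_eq_left ha, max_eq_left hb]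
  rcases le_total a b with h | h
  · rw [max_eq_left (by linarith : 0 ≤ b - a), max_eq_right (by linarith : a - b ≤ 0)]; ring
  · rw [max_eq_right (by linarith : b - a ≤ 0), max_eq_left (by linarith : 0 ≤ a - b)]; ring

lemma mul_clampLen_le {a h : ℝ} (ha : 0 ≤ a) (hh : 0 ≤ h) (v : ℝ) :
    h * clampLen a (v - h) ≤ clampPrim a v - clampPrim a (v - h) := by
  unfold clampPrim clampLen
  rcases le_total v 0 with h1 | h1
  · rw [max_eq_right h1, max_eq_right (by linarith : v - a ≤ 0),
      max_eq_right (by linarith : v - h ≤ 0), max_eq_right (by linarith : v - h - a ≤ 0),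
      max_eq_left ((min_le_right _ _).trans (by linarith : v - h ≤ 0))]
    simp
  rw [max_eq_left h1]
  rcases le_total (v - h) 0 with h2 | h2
  · rw [max_eq_right h2, max_eq_right (by linarith : v - h - a ≤ 0),
      max_eq_left ((min_le_right _ _).trans h2)]
    rcases le_total (v - a) 0 with h3 | h3
    · rw [max_eq_right h3]; nlinarith
    · rw [max_eq_left h3]; nlinarith
  rw [max_eq_left h2]
  rcases le_total a (v - h) with h3 | h3
  · rw [min_eq_left h3, max_eq_right ha, max_eq_left (by linarith : 0 ≤ v - a),
      max_eq_left (by linarith : 0 ≤ v - h - a)]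
    nlinarith
  · rw [min_eq_right h3, max_eq_right h2, max_eq_right (by linarith : v - h - a ≤ 0)]
    rcases le_total (v - a) 0 with h4 | h4
    · rw [max_eq_right h4]; nlinarith
    · rw [max_eq_left h4]; nlinarith

lemma sum_mul_clampLen_le {a h : ℝ} (ha : 0 ≤ a) (hh : 0 ≤ h) (b : ℝ) (T : ℕ) :
    ∑ t ∈ Finset.range T, h * clampLen a (b - ((t + 1 : ℕ) : ℝ) * h) ≤ clampPrim a b := by
  have key : ∀ T : ℕ, ∑ t ∈ Finset.range T, h * clampLen a (b - ((t + 1 : ℕ) : ℝ) * h)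
      ≤ clampPrim a b - clampPrim a (b - T * h) := by
    intro T
    induction T with
    | zero => simp
    | succ T ih =>
      rw [Finset.sum_range_succ]
      have := mul_clampLen_le ha hh (b - T * h)
      have e : b - T * h - h = b - ((T + 1 : ℕ) : ℝ) * h := by push_cast; ring
      rw [e] at this
      linarith
  exact (key T).trans (by linarith [clampPrim_nonneg ha (b - T * h)])

/-- The number of pairs of fractions with denominators `g * v`, `g * w` (with `v`, `w` coprime)
and a prescribed difference is at most `g`. -/
lemma card_fractions_with_difference_le {g v w : ℕ} (hv : 0 < v) (hvw : Nat.Coprime v w) (t : ℕ) :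
    ((Finset.range (g * v) ×ˢ Finset.range (g * w)).filter
      (fun x : ℕ × ℕ => x.1 * w = x.2 * v + t)).card ≤ g := by
  calc _ ≤ (Finset.range g).card := by
        apply Finset.card_le_card_of_injOn (fun x : ℕ × ℕ => x.1 / v)
        · intro x hx
          simp only [Finset.coe_filter, Finset.mem_product, Finset.mem_range,
            Set.mem_ofPred_eq] at hx
          simpa using (Nat.div_lt_iff_lt_mul hv).2 hx.1.1
        · rintro ⟨p, p'⟩ hx ⟨q, q'⟩ hy hxy
          simp only [Finset.coe_filter, Finset.mem_product, Finset.mem_range,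
            Set.mem_ofPred_eq] at hx hy hxy
          have hmod : p ≡ q [MOD v] := by
            apply Nat.ModEq.cancel_right_of_coprime (c := w) (by simpa using hvw)
            rw [hx.2, hy.2]
            exact Nat.ModEq.add_right _ (by simp [Nat.ModEq])
          have hpq : p = q := by
            rw [← Nat.div_add_mod p v, ← Nat.div_add_mod q v, hxy, hmod]
          subst hpq
          have : p' * v = q' * v := by omega
          rw [Nat.eq_of_mul_eq_mul_right hv this]
    _ = g := Finset.card_range g

lemma sum_clampLen_pairs_le {n m : ℕ} (hn : 0 < n) (hm : 0 < m) {a b : ℝ} (ha : 0 ≤ a) :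
    ∑ x ∈ (Finset.range n ×ˢ Finset.range m).filter (fun x : ℕ × ℕ => x.2 * n < x.1 * m),
      clampLen a (b - ((x.1 : ℝ) / n - (x.2 : ℝ) / m)) ≤ n * m * clampPrim a b := by
  obtain ⟨v, w, hvw, hnv, hmw⟩ := Nat.exists_coprime n m
  set g := Nat.gcd n m
  have hg : 0 < g := Nat.gcd_pos_of_pos_left m hn
  have hv : 0 < v := Nat.pos_of_ne_zero (by rintro rfl; simp at hnv; omega)
  have hw : 0 < w := Nat.pos_of_ne_zero (by rintro rfl; simp at hmw; omega)
  have hnv' : n = g * v := by rw [hnv, mul_comm]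
  have hmw' : m = g * w := by rw [hmw, mul_comm]
  clear_value g
  subst hnv' hmw'
  have hgR : (0 : ℝ) < g := by exact_mod_cast hg
  have hvR : (0 : ℝ) < v := by exact_mod_cast hv
  have hwR : (0 : ℝ) < w := by exact_mod_cast hw
  set P := (Finset.range (g * v) ×ˢ Finset.range (g * w)).filter
    (fun x : ℕ × ℕ => x.2 * (g * v) < x.1 * (g * w)) with hP
  have hlt : ∀ x ∈ P, x.2 * v < x.1 * w ∧ x.1 < g * v := by
    intro x hx
    simp only [hP, Finset.mem_filter, Finset.mem_product, Finset.mem_range] at hx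
    refine ⟨?_, hx.1.1⟩
    have := hx.2
    rw [show x.2 * (g * v) = g * (x.2 * v) by ring, show x.1 * (g * w) = g * (x.1 * w) by ring]
      at this
    exact lt_of_mul_lt_mul_left this (Nat.zero_le g)
  set h : ℝ := 1 / (g * v * w) with hh
  have hh0 : 0 ≤ h := by positivity
  have hmaps : ∀ x ∈ P, x.1 * w - x.2 * v - 1 ∈ Finset.range (g * v * w) := by
    intro x hx
    have := hlt x hx
    have h2 : x.1 * w < g * v * w := Nat.mul_lt_mul_of_pos_right this.2 hw
    simp; omega
  rw [← Finset.sum_fiberwise_of_maps_to hmaps]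
  calc _ ≤ ∑ t ∈ Finset.range (g * v * w), (g : ℝ) * clampLen a (b - ((t + 1 : ℕ) : ℝ) * h) := by
        apply Finset.sum_le_sum
        intro t _
        have hval : ∀ x ∈ P.filter (fun x => x.1 * w - x.2 * v - 1 = t),
            clampLen a (b - ((x.1 : ℝ) / (g * v : ℕ) - (x.2 : ℝ) / (g * w : ℕ)))
              ≤ clampLen a (b - ((t + 1 : ℕ) : ℝ) * h) := by
          intro x hx
          rw [Finset.mem_filter] at hx
          have h1 := hlt x hx.1
          have h2 : x.1 * w = x.2 * v + (t + 1) := by omega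
          have h3 : (x.1 : ℝ) * w = x.2 * v + (t + 1 : ℕ) := by exact_mod_cast h2
          apply le_of_eq
          congr 2
          rw [hh]
          push_cast at h3 ⊢
          field_simp
          linarith
        refine (Finset.sum_le_card_nsmul _ _ _ hval).trans ?_
        rw [nsmul_eq_mul]
        apply mul_le_mul_of_nonneg_right _ (clampLen_nonneg _ _)
        have : (P.filter (fun x => x.1 * w - x.2 * v - 1 = t)).card ≤ g := by
          refine (Finset.card_le_card ?_).trans
            (card_fractions_with_difference_le (g := g) hv hvw (t + 1))
          intro x hx
          rw [Finset.mem_filter] at hx ⊢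
          have h1 := hlt x hx.1
          refine ⟨(Finset.mem_filter.1 hx.1).1, by omega⟩
        exact_mod_cast this
    _ = (g * v * (g * w)) * ∑ t ∈ Finset.range (g * v * w),
          h * clampLen a (b - ((t + 1 : ℕ) : ℝ) * h) := by
        rw [Finset.mul_sum]
        refine Finset.sum_congr rfl fun t _ => ?_
        rw [← mul_assoc]
        congr 1
        rw [hh]; field_simp
    _ ≤ _ := by
        have := mul_le_mul_of_nonneg_left (sum_mul_clampLen_le ha hh0 b (g * v * w))
          (by positivity : (0 : ℝ) ≤ g * v * (g * w))
        push_cast at this ⊢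
        exact this

open MeasureTheory in
lemma volume_Ioc_inter_Ioc_le {x y a b : ℝ} (h : y ≤ x) :
    volume.real (Set.Ioc x (x + a) ∩ Set.Ioc y (y + b)) ≤ clampLen a (b - (x - y)) := by
  rw [Set.Ioc_inter_Ioc, Real.volume_real_Ioc, clampLen, max_comm, max_eq_left h]
  refine max_le_max le_rfl (le_min ?_ ?_)
  · linarith [min_le_left (x + a) (y + b)]
  · linarith [min_le_right (x + a) (y + b)]

open MeasureTheory in
lemma sum_volume_inter_le {n m : ℕ} (hn : 0 < n) (hm : 0 < m) {a b : ℝ} (ha : 0 ≤ a)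
    (hb : 0 ≤ b) :
    ∑ p ∈ Finset.range n, ∑ q ∈ Finset.range m,
      (if p * m = q * n then 0 else
        volume.real (Set.Ioc ((p : ℝ) / n) (p / n + a) ∩ Set.Ioc ((q : ℝ) / m) (q / m + b)))
      ≤ n * m * (a * b) := by
  have hnR : (0 : ℝ) < n := by exact_mod_cast hn
  have hmR : (0 : ℝ) < m := by exact_mod_cast hm
  have h1 := sum_clampLen_pairs_le hn hm (b := b) ha
  have h2 := sum_clampLen_pairs_le hm hn (b := a) hb
  rw [Finset.sum_filter, Finset.sum_product] at h1 h2
  rw [Finset.sum_comm] at h2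
  rw [← clampPrim_add_swap ha hb, mul_add]
  have h2' : (m * n : ℝ) * clampPrim b a = n * m * clampPrim b a := by ring
  rw [h2'] at h2
  refine le_trans ?_ (add_le_add h1 h2)
  rw [← Finset.sum_add_distrib]
  refine Finset.sum_le_sum fun p _ => ?_
  rw [← Finset.sum_add_distrib]
  refine Finset.sum_le_sum fun q _ => ?_
  rcases lt_trichotomy (p * m) (q * n) with h | h | h
  · rw [if_neg h.ne, if_neg h.not_gt, if_pos h, zero_add, Set.inter_comm]
    apply volume_Ioc_inter_Ioc_le
    rw [div_le_div_iff₀ hnR hmR]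
    exact_mod_cast h.le
  · simp [h]
  · rw [if_neg h.ne', if_neg h.not_gt, if_pos h, add_zero]
    apply volume_Ioc_inter_Ioc_le
    rw [div_le_div_iff₀ hmR hnR]
    exact_mod_cast h.le

/-- Pairs `⟨n, p⟩` with `k ≤ n ≤ N` and `p < n`, standing for the fractions `p / n`. -/
def fracs (k N : ℕ) : Finset (Σ _ : ℕ, ℕ) := (Finset.Icc k N).sigma fun n => Finset.range n

/-- The interval of length `c / n ^ 2` to the right of `p / n`. -/
noncomputable def arc (c : ℝ) (s : Σ _ : ℕ, ℕ) : Set ℝ :=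
  Set.Ioc ((s.2 : ℝ) / s.1) (s.2 / s.1 + c / (s.1 : ℝ) ^ 2)

lemma mem_fracs {k N : ℕ} {s : Σ _ : ℕ, ℕ} :
    s ∈ fracs k N ↔ (k ≤ s.1 ∧ s.1 ≤ N) ∧ s.2 < s.1 := by
  simp [fracs]

lemma card_proportional_le (S : Finset (Σ _ : ℕ, ℕ)) (s : Σ _ : ℕ, ℕ) (hs : 0 < s.1) (G : ℕ)
    (hS : ∀ s ∈ S, 0 < s.1 ∧ Nat.gcd s.1 s.2 ≤ G) :
    (S.filter fun r => s.2 * r.1 = r.2 * s.1).card ≤ G := by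
  calc _ ≤ (Finset.Icc 1 G).card := by
        apply Finset.card_le_card_of_injOn (fun r => Nat.gcd r.1 r.2)
        · intro r hr
          have hr := (Finset.mem_filter.1 (Finset.mem_coe.1 hr)).1
          simpa using ⟨Nat.gcd_pos_of_pos_left _ (hS r hr).1, (hS r hr).2⟩
        · rintro ⟨n, p⟩ hr ⟨m, q⟩ hr' h
          have hr := Finset.mem_filter.1 (Finset.mem_coe.1 hr)
          have hr' := Finset.mem_filter.1 (Finset.mem_coe.1 hr')
          have hn := (hS _ hr.1).1
          have hm := (hS _ hr'.1).1
          have e1 := hr.2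
          have e2 := hr'.2
          simp only at h e1 e2 hn hm
          have e : p * m = q * n := by
            apply Nat.eq_of_mul_eq_mul_right hs
            calc p * m * s.1 = p * s.1 * m := by ring
              _ = (q * s.1) * n := by rw [← e1, ← e2]; ring
              _ = _ := by ring
          have hnm : n = m := by
            obtain ⟨v, a, hva, hnv, hpa⟩ := Nat.exists_coprime n p
            obtain ⟨w, b, hwb, hmw, hqb⟩ := Nat.exists_coprime m q
            rw [← h] at hmw hqb
            have hg : 0 < Nat.gcd n p := Nat.gcd_pos_of_pos_left _ hn
            set g := Nat.gcd n p
            have e' : a * w = b * v := by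
              apply Nat.eq_of_mul_eq_mul_right (Nat.mul_pos hg hg)
              calc a * w * (g * g) = (a * g) * (w * g) := by ring
                _ = (b * g) * (v * g) := by rw [← hpa, ← hmw, ← hqb, ← hnv, e]
                _ = _ := by ring
            have hvw : v ∣ w := hva.dvd_of_dvd_mul_left (e' ▸ Dvd.intro_left b rfl)
            have hwv : w ∣ v := hwb.dvd_of_dvd_mul_left (e' ▸ Dvd.intro_left a rfl)
            rw [hnv, hmw, Nat.dvd_antisymm hvw hwv]
          subst hnm
          rw [Nat.eq_of_mul_eq_mul_right hn e]
    _ = G := by simp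

lemma sum_fracs_large_gcd_le {c : ℝ} (hc : 0 ≤ c) {k : ℕ} (hk : 0 < k) (N : ℕ) {G : ℕ}
    (hG : 0 < G) :
    ∑ s ∈ (fracs k N).filter (fun s => ¬ Nat.gcd s.1 s.2 ≤ G), c / (s.1 : ℝ) ^ 2
      ≤ (c * ∑ n ∈ Finset.Icc 1 N, (1 : ℝ) / n) / G := by
  set H := ∑ n ∈ Finset.Icc 1 N, (1 : ℝ) / n with hH
  have hH0 : 0 ≤ H := Finset.sum_nonneg fun _ _ => by positivity
  have hmaps : ∀ s ∈ (fracs k N).filter (fun s => ¬ Nat.gcd s.1 s.2 ≤ G),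
      Nat.gcd s.1 s.2 ∈ Finset.Ioc G N := by
    intro s hs
    rw [Finset.mem_filter, mem_fracs] at hs
    have := Nat.gcd_le_left s.2 (show 0 < s.1 by omega)
    simp; omega
  rw [← Finset.sum_fiberwise_of_maps_to hmaps]
  calc _ ≤ ∑ g ∈ Finset.Ioc G N, ((g : ℝ) ^ 2)⁻¹ * (c * H) := by
        apply Finset.sum_le_sum
        intro g hg
        have hg0 : 0 < g := by simp at hg; omega
        have hgR : (0 : ℝ) < g := by exact_mod_cast hg0
        set F := ((fracs k N).filter (fun s => ¬ Nat.gcd s.1 s.2 ≤ G)).filter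
          (fun s => Nat.gcd s.1 s.2 = g)
        have hF : ∀ s ∈ F, (s.1 = g * (s.1 / g) ∧ s.2 = g * (s.2 / g)) ∧ s ∈ fracs k N := by
          intro s hs
          simp only [F, Finset.mem_filter] at hs
          have h1 : g ∣ s.1 := hs.2 ▸ Nat.gcd_dvd_left _ _
          have h2 : g ∣ s.2 := hs.2 ▸ Nat.gcd_dvd_right _ _
          exact ⟨⟨(Nat.mul_div_cancel' h1).symm, (Nat.mul_div_cancel' h2).symm⟩, hs.1.1⟩
        let φ : (Σ _ : ℕ, ℕ) → (Σ _ : ℕ, ℕ) := fun s => ⟨s.1 / g, s.2 / g⟩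
        have hinj : Set.InjOn φ F := by
          rintro ⟨n, p⟩ hs ⟨m, q⟩ hs' h
          have h1 := (hF _ hs).1
          have h2 := (hF _ hs').1
          simp only [φ, Sigma.mk.injEq, heq_eq_eq] at h h1 h2
          rw [h1.1, h1.2, h.1, h.2, ← h2.1, ← h2.2]
        calc ∑ s ∈ F, c / (s.1 : ℝ) ^ 2
            = ∑ s ∈ F, (fun r : (Σ _ : ℕ, ℕ) => ((g : ℝ) ^ 2)⁻¹ * (c / (r.1 : ℝ) ^ 2)) (φ s) := by
              refine Finset.sum_congr rfl fun s hs => ?_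
              have h1 := (hF s hs).1.1
              have h2 : (s.1 : ℝ) = g * (s.1 / g : ℕ) := by exact_mod_cast h1
              simp only [φ]
              rw [h2, mul_pow, div_mul_eq_div_div, div_eq_mul_inv c, div_eq_mul_inv, div_eq_mul_inv]
              ring
          _ = ∑ r ∈ F.image φ, ((g : ℝ) ^ 2)⁻¹ * (c / (r.1 : ℝ) ^ 2) :=
              (Finset.sum_image (f := fun r : (Σ _ : ℕ, ℕ) =>
                ((g : ℝ) ^ 2)⁻¹ * (c / (r.1 : ℝ) ^ 2)) hinj).symm
          _ ≤ ∑ r ∈ fracs 1 N, ((g : ℝ) ^ 2)⁻¹ * (c / (r.1 : ℝ) ^ 2) := by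
              apply Finset.sum_le_sum_of_subset_of_nonneg
              · intro r hr
                obtain ⟨s, hs, rfl⟩ := Finset.mem_image.1 hr
                obtain ⟨⟨h1, h2⟩, h3⟩ := hF s hs
                rw [mem_fracs] at h3 ⊢
                simp only [φ]
                refine ⟨⟨?_, (Nat.div_le_self _ _).trans h3.1.2⟩, ?_⟩
                · refine Nat.pos_of_ne_zero fun h => ?_
                  rw [h] at h1
                  omega
                · apply lt_of_mul_lt_mul_left _ (Nat.zero_le g)
                  rw [← h1, ← h2]
                  exact h3.2
              · intros; positivity
          _ = ((g : ℝ) ^ 2)⁻¹ * (c * H) := by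
              rw [← Finset.mul_sum, fracs, Finset.sum_sigma, hH, Finset.mul_sum (a := c)]
              congr 1
              refine Finset.sum_congr rfl fun n hn => ?_
              have : (n : ℝ) ≠ 0 := by
                have := (Finset.mem_Icc.1 hn).1
                positivity
              simp
              field_simp
    _ ≤ _ := by
        rw [← Finset.sum_mul]
        rw [div_eq_inv_mul]
        apply mul_le_mul_of_nonneg_right _ (by positivity)
        rcases le_total G N with h | h
        · refine (sum_Ioc_inv_sq_le_sub hG.ne' h).trans ?_
          have : (0 : ℝ) ≤ (N : ℝ)⁻¹ := by positivity
          linarith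
        · rw [Finset.Ioc_eq_empty (by omega)]
          simp

open MeasureTheory

/-- The number of arcs of the fractions in `S` that contain `β`. -/
noncomputable def hits (c : ℝ) (S : Finset (Σ _ : ℕ, ℕ)) (β : ℝ) : ℝ :=
  ∑ s ∈ S, (arc c s).indicator 1 β

lemma measurableSet_arc (c : ℝ) (s : Σ _ : ℕ, ℕ) : MeasurableSet (arc c s) := measurableSet_Ioc

lemma volume_arc {c : ℝ} (hc : 0 ≤ c) (s : Σ _ : ℕ, ℕ) :
    volume.real (arc c s) = c / (s.1 : ℝ) ^ 2 := by
  rw [arc, Real.volume_real_Ioc, add_sub_cancel_left, max_eq_left (by positivity)]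

lemma arc_subset {c : ℝ} {k N : ℕ} (hk : 0 < k) (hck : c ≤ k) {s : Σ _ : ℕ, ℕ}
    (hs : s ∈ fracs k N) : arc c s ⊆ Set.Ioc 0 1 := by
  rw [mem_fracs] at hs
  have h1 : (0 : ℝ) < s.1 := by exact_mod_cast (show 0 < s.1 by omega)
  have h2 : (s.2 : ℝ) + 1 ≤ s.1 := by exact_mod_cast hs.2
  have h3 : (k : ℝ) ≤ s.1 := by exact_mod_cast hs.1.1
  intro x hx
  have hx' : (s.2 : ℝ) / s.1 < x ∧ x ≤ s.2 / s.1 + c / (s.1 : ℝ) ^ 2 := hx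
  refine ⟨lt_of_le_of_lt (by positivity) hx'.1, hx'.2.trans ?_⟩
  have h4 : c / (s.1 : ℝ) ^ 2 ≤ 1 / s.1 := by
    rw [div_le_div_iff₀ (by positivity) h1]
    nlinarith
  calc _ ≤ (s.2 : ℝ) / s.1 + 1 / s.1 := by linarith
    _ = (s.2 + 1) / s.1 := by ring
    _ ≤ 1 := (div_le_one h1).2 h2

lemma integrable_indicator_one {A : Set ℝ} (hA : MeasurableSet A) :
    Integrable (A.indicator (1 : ℝ → ℝ)) (volume.restrict (Set.Ioc 0 1)) :=
  (integrable_const (1 : ℝ)).indicator hA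

lemma integrable_hits (c : ℝ) (S : Finset (Σ _ : ℕ, ℕ)) :
    Integrable (hits c S) (volume.restrict (Set.Ioc 0 1)) :=
  integrable_finsetSum _ fun _ _ => integrable_indicator_one (measurableSet_arc _ _)

lemma integral_hits {c : ℝ} (hc : 0 ≤ c) {k N : ℕ} (hk : 0 < k) (hck : c ≤ k)
    {S : Finset (Σ _ : ℕ, ℕ)} (hS : S ⊆ fracs k N) :
    ∫ β in Set.Ioc 0 1, hits c S β = ∑ s ∈ S, c / (s.1 : ℝ) ^ 2 := by
  unfold hits
  rw [integral_finsetSum _ fun _ _ => integrable_indicator_one (measurableSet_arc _ _)]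
  refine Finset.sum_congr rfl fun s hs => ?_
  rw [integral_indicator_one (measurableSet_arc _ _),
    measureReal_restrict_apply (measurableSet_arc _ _),
    Set.inter_eq_left.2 (arc_subset hk hck (hS hs)), volume_arc hc]

lemma sum_fracs_eq (c : ℝ) {k : ℕ} (hk : 0 < k) (N : ℕ) :
    ∑ s ∈ fracs k N, c / (s.1 : ℝ) ^ 2 = c * ∑ n ∈ Finset.Icc k N, (1 : ℝ) / n := by
  rw [fracs, Finset.sum_sigma, Finset.mul_sum]
  refine Finset.sum_congr rfl fun n hn => ?_
  have : (n : ℝ) ≠ 0 := by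
    have := (Finset.mem_Icc.1 hn).1
    have : 0 < n := by omega
    positivity
  simp
  field_simp

lemma hits_sq_eq (c : ℝ) (S : Finset (Σ _ : ℕ, ℕ)) (β : ℝ) :
    hits c S β ^ 2 = ∑ s ∈ S, ∑ r ∈ S, (arc c s ∩ arc c r).indicator (1 : ℝ → ℝ) β := by
  rw [sq, hits, Finset.sum_mul_sum]
  refine Finset.sum_congr rfl fun s _ => Finset.sum_congr rfl fun r _ => ?_
  rw [Set.inter_indicator_one]
  rfl

lemma integrable_hits_sq (c : ℝ) (S : Finset (Σ _ : ℕ, ℕ)) :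
    Integrable (fun β => hits c S β ^ 2) (volume.restrict (Set.Ioc 0 1)) := by
  simp_rw [hits_sq_eq]
  exact integrable_finsetSum _ fun _ _ => integrable_finsetSum _ fun _ _ =>
    integrable_indicator_one ((measurableSet_arc _ _).inter (measurableSet_arc _ _))

lemma volume_inter_arc_ne_top (c : ℝ) (s : Σ _ : ℕ, ℕ) (A : Set ℝ) :
    volume (arc c s ∩ A) ≠ ⊤ :=
  measure_ne_top_of_subset Set.inter_subset_left (by rw [arc, Real.volume_Ioc]; simp)

lemma integral_hits_sq_le {c : ℝ} (hc : 0 ≤ c) {k N G : ℕ} (hk : 0 < k)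
    {S : Finset (Σ _ : ℕ, ℕ)} (hS : S ⊆ fracs k N) (hG : ∀ s ∈ S, Nat.gcd s.1 s.2 ≤ G) :
    ∫ β in Set.Ioc 0 1, hits c S β ^ 2 ≤
      (c * ∑ n ∈ Finset.Icc k N, (1 : ℝ) / n) ^ 2
        + G * (c * ∑ n ∈ Finset.Icc k N, (1 : ℝ) / n) := by
  have hpos : ∀ s ∈ fracs k N, 0 < s.1 := fun s hs => by rw [mem_fracs] at hs; omega
  have hM : (c * ∑ n ∈ Finset.Icc k N, (1 : ℝ) / n) = ∑ s ∈ fracs k N, c / (s.1 : ℝ) ^ 2 :=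
    (sum_fracs_eq c hk N).symm
  simp_rw [hits_sq_eq]
  rw [integral_finsetSum _ fun _ _ => integrable_finsetSum _ fun _ _ =>
    integrable_indicator_one ((measurableSet_arc _ _).inter (measurableSet_arc _ _))]
  have h1 : ∀ s ∈ S, ∫ β in Set.Ioc 0 1, ∑ r ∈ S, (arc c s ∩ arc c r).indicator (1 : ℝ → ℝ) β
      ≤ ∑ r ∈ S, (if s.2 * r.1 = r.2 * s.1 then 0 else volume.real (arc c s ∩ arc c r))
        + G * (c / (s.1 : ℝ) ^ 2) := by
    intro s hs
    rw [integral_finsetSum _ fun _ _ =>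
      integrable_indicator_one ((measurableSet_arc _ _).inter (measurableSet_arc _ _))]
    have h2 : ∀ r ∈ S, ∫ β in Set.Ioc 0 1, (arc c s ∩ arc c r).indicator (1 : ℝ → ℝ) β
        ≤ (if s.2 * r.1 = r.2 * s.1 then 0 else volume.real (arc c s ∩ arc c r))
          + (if s.2 * r.1 = r.2 * s.1 then c / (s.1 : ℝ) ^ 2 else 0) := by
      intro r _
      rw [integral_indicator_one ((measurableSet_arc _ _).inter (measurableSet_arc _ _)),
        measureReal_restrict_apply ((measurableSet_arc _ _).inter (measurableSet_arc _ _))]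
      split_ifs
      · rw [zero_add, ← volume_arc hc]
        apply measureReal_mono
        · exact Set.inter_subset_left.trans Set.inter_subset_left
        · simpa using volume_inter_arc_ne_top c s Set.univ
      · rw [add_zero]
        exact measureReal_mono Set.inter_subset_left (volume_inter_arc_ne_top _ _ _)
    refine (Finset.sum_le_sum h2).trans ?_
    rw [Finset.sum_add_distrib]
    gcongr
    rw [← Finset.sum_filter, Finset.sum_const, nsmul_eq_mul]
    have := card_proportional_le S s (hpos s (hS hs)) G fun r hr => ⟨hpos r (hS hr), hG r hr⟩
    gcongr
  refine (Finset.sum_le_sum h1).trans ?_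
  rw [Finset.sum_add_distrib, ← Finset.mul_sum]
  have hdiag : ∑ s ∈ S, c / (s.1 : ℝ) ^ 2 ≤ ∑ s ∈ fracs k N, c / (s.1 : ℝ) ^ 2 :=
    Finset.sum_le_sum_of_subset_of_nonneg hS fun _ _ _ => by positivity
  have hnn : ∀ s r : (Σ _ : ℕ, ℕ),
      (0 : ℝ) ≤ if s.2 * r.1 = r.2 * s.1 then 0 else volume.real (arc c s ∩ arc c r) := by
    intro s r
    split_ifs
    · exact le_rfl
    · exact measureReal_nonneg
  refine add_le_add ?_ (mul_le_mul_of_nonneg_left (hM ▸ hdiag) (Nat.cast_nonneg G))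
  calc _ ≤ ∑ s ∈ fracs k N, ∑ r ∈ fracs k N,
        (if s.2 * r.1 = r.2 * s.1 then 0 else volume.real (arc c s ∩ arc c r)) := by
        refine (Finset.sum_le_sum fun s _ =>
          Finset.sum_le_sum_of_subset_of_nonneg hS fun r _ _ => hnn s r).trans ?_
        exact Finset.sum_le_sum_of_subset_of_nonneg hS fun s _ _ =>
          Finset.sum_nonneg fun r _ => hnn s r
    _ = ∑ n ∈ Finset.Icc k N, ∑ m ∈ Finset.Icc k N, ∑ p ∈ Finset.range n, ∑ q ∈ Finset.range m,
        (if p * m = q * n then 0 else volume.real (arc c ⟨n, p⟩ ∩ arc c ⟨m, q⟩)) := by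
        simp_rw [fracs, Finset.sum_sigma]
        refine Finset.sum_congr rfl fun n _ => ?_
        rw [Finset.sum_comm]
    _ ≤ ∑ n ∈ Finset.Icc k N, ∑ m ∈ Finset.Icc k N, (c * (1 / n)) * (c * (1 / m)) := by
        refine Finset.sum_le_sum fun n hn => Finset.sum_le_sum fun m hm => ?_
        have hn0 : 0 < n := by rw [Finset.mem_Icc] at hn; omega
        have hm0 : 0 < m := by rw [Finset.mem_Icc] at hm; omega
        have hnR : (0 : ℝ) < n := by exact_mod_cast hn0
        have hmR : (0 : ℝ) < m := by exact_mod_cast hm0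
        refine (sum_volume_inter_le hn0 hm0 (a := c / (n : ℝ) ^ 2) (b := c / (m : ℝ) ^ 2)
          (by positivity) (by positivity)).trans (le_of_eq ?_)
        field_simp
    _ = _ := by rw [← Finset.sum_mul_sum, ← Finset.mul_sum, sq]

/-- A quantitative mean estimate for the number of good approximations. -/
lemma integral_abs_hits_sub_le {c : ℝ} (hc : 0 < c) {k N G : ℕ} (hk : 0 < k) (hck : c ≤ k)
    (hN : 0 < N) (hG : 0 < G) {K : ℝ} (hK : 0 < K) {A : ℝ}
    (hA : A = c * ∑ n ∈ Finset.Icc 1 N, (1 : ℝ) / n) :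
    ∫ β in Set.Ioc 0 1, |hits c (fracs k N) β - c * ∑ n ∈ Finset.Icc k N, (1 : ℝ) / n|
      ≤ A / G + (A / K + K * (G + 2 * (A / G))) / 2 := by
  set M := c * ∑ n ∈ Finset.Icc k N, (1 : ℝ) / n with hM
  set S := (fracs k N).filter (fun s => Nat.gcd s.1 s.2 ≤ G) with hS
  set S' := (fracs k N).filter (fun s => ¬ Nat.gcd s.1 s.2 ≤ G) with hS'
  have hSsub : S ⊆ fracs k N := Finset.filter_subset _ _
  have hS'sub : S' ⊆ fracs k N := Finset.filter_subset _ _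
  have hA0 : 0 < A := by
    rw [hA]
    apply mul_pos hc
    apply Finset.sum_pos
    · intro i hi
      have : 0 < i := (Finset.mem_Icc.1 hi).1
      positivity
    · exact ⟨1, by simp; omega⟩
  have hM0 : 0 ≤ M := mul_nonneg hc.le (Finset.sum_nonneg fun _ _ => by positivity)
  have hMA : M ≤ A := by
    rw [hA]
    refine mul_le_mul_of_nonneg_left ?_ hc.le
    exact Finset.sum_le_sum_of_subset_of_nonneg (Finset.Icc_subset_Icc_left hk)
      fun _ _ _ => by positivity
  set T := ∑ s ∈ S', c / (s.1 : ℝ) ^ 2 with hT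
  have hTA : T ≤ A / G := by rw [hA]; exact sum_fracs_large_gcd_le hc.le hk N hG
  have hT0 : 0 ≤ T := Finset.sum_nonneg fun _ _ => by positivity
  have hsum : ∀ β, hits c (fracs k N) β = hits c S β + hits c S' β := fun β =>
    (Finset.sum_filter_add_sum_filter_not _ _ _).symm
  have hST : ∑ s ∈ S, c / (s.1 : ℝ) ^ 2 = M - T := by
    have := Finset.sum_filter_add_sum_filter_not (fracs k N) (fun s => Nat.gcd s.1 s.2 ≤ G)
      (fun s => c / (s.1 : ℝ) ^ 2)
    rw [sum_fracs_eq c hk N] at this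
    linarith
  have hi1 := integral_hits hc.le hk hck hSsub
  have hi2 := integral_hits hc.le hk hck hS'sub
  have hi3 := integral_hits_sq_le hc.le hk hSsub (G := G) fun s hs => (Finset.mem_filter.1 hs).2
  rw [hST] at hi1
  rw [← hT] at hi2
  rw [← hM] at hi3
  have hI1 := integrable_hits c S
  have hI2 := integrable_hits c S'
  have hI3 := integrable_hits_sq c S
  have hone : ∀ x : ℝ, ∫ _ in Set.Ioc (0 : ℝ) 1, x = x := by intro x; simp
  have hbound : ∀ β, |hits c (fracs k N) β - M| ≤
      hits c S' β + ((A / K + K / A * M ^ 2) / 2 + K / A / 2 * hits c S β ^ 2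
        - K / A * M * hits c S β) := by
    intro β
    have h1 : 0 ≤ hits c S' β := Finset.sum_nonneg fun s _ =>
      Set.indicator_nonneg (fun _ _ => zero_le_one) _
    rw [hsum β]
    set y := hits c S β - M with hy
    have h2 : |y| ≤ (A / K + K / A * y ^ 2) / 2 := by
      have h4 : A / K + K / A * y ^ 2 - 2 * |y| = K / A * (|y| - A / K) ^ 2 := by
        rw [← sq_abs y]; field_simp; ring
      have h5 : 0 ≤ K / A * (|y| - A / K) ^ 2 := by positivity
      linarith
    have h3 : (A / K + K / A * y ^ 2) / 2 = ((A / K + K / A * M ^ 2) / 2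
        + K / A / 2 * hits c S β ^ 2 - K / A * M * hits c S β) := by
      rw [hy]; ring
    calc |hits c S β + hits c S' β - M| = |y + hits c S' β| := by rw [hy]; congr 1; ring
      _ ≤ |y| + |hits c S' β| := abs_add_le _ _
      _ ≤ _ := by rw [abs_of_nonneg h1]; linarith
  have hJ : Integrable (fun β => (A / K + K / A * M ^ 2) / 2 + K / A / 2 * hits c S β ^ 2)
      (volume.restrict (Set.Ioc 0 1)) := (integrable_const _).add (hI3.const_mul _)
  have hJ' : Integrable (fun β => (A / K + K / A * M ^ 2) / 2 + K / A / 2 * hits c S β ^ 2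
      - K / A * M * hits c S β) (volume.restrict (Set.Ioc 0 1)) := hJ.sub (hI1.const_mul _)
  refine (integral_mono (((integrable_hits c _).sub (integrable_const _)).abs)
    (hI2.add hJ') hbound).trans ?_
  rw [integral_add' hI2 hJ', integral_sub hJ (hI1.const_mul _),
    integral_add (integrable_const _) (hI3.const_mul _), integral_const_mul, integral_const_mul,
    hone, hi1, hi2]
  have hKA : 0 ≤ K / A := by positivity
  have e1 : K / A / 2 * (∫ β in Set.Ioc 0 1, hits c S β ^ 2) ≤ K / A / 2 * (M ^ 2 + G * M) :=
    mul_le_mul_of_nonneg_left hi3 (by positivity)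
  have e2 : K / A * M * (G + 2 * T) ≤ K * (G + 2 * (A / G)) := by
    have : K / A * M ≤ K := by
      rw [div_mul_eq_mul_div, div_le_iff₀ hA0]
      exact mul_le_mul_of_nonneg_left hMA hK.le
    have h0 : (0 : ℝ) ≤ G := Nat.cast_nonneg G
    apply mul_le_mul this (by linarith) (by linarith) hK.le
  have e3 : K / A * M * (M - T) = K / A * M ^ 2 - K / A * M * T := by ring
  have e4 : K / A / 2 * (M ^ 2 + G * M) = K / A * M ^ 2 / 2 + K / A * M * G / 2 := by ring
  rw [e3]
  rw [e4] at e1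
  have e5 : K / A * M * (G + 2 * T) = K / A * M * G + 2 * (K / A * M * T) := by ring
  linarith

open Filter Topology

/-- The set `S` of natural numbers satisfies `|S ∩ [1, n]| / log n → c`. -/
def HasLogGrowth (S : Set ℕ) (c : ℝ) : Prop :=
  Tendsto (fun n : ℕ => ((S ∩ Set.Icc 1 n).ncard : ℝ) / Real.log n) atTop (𝓝 c)

/-- The `n ≥ 1` for which `n * β` exceeds an integer by a positive amount of at most `c / n`. -/
def approxSet (c β : ℝ) : Set ℕ :=
  {n | 0 < n ∧ ∃ p : ℤ, 0 < n * β - p ∧ n * β - p ≤ c / n}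

lemma approxSet_add_int (c β : ℝ) (j : ℤ) : approxSet c (β + j) = approxSet c β := by
  ext n
  refine and_congr_right fun _ => ⟨?_, ?_⟩
  · rintro ⟨p, h1, h2⟩
    refine ⟨p - n * j, ?_, ?_⟩ <;> push_cast <;> linarith
  · rintro ⟨p, h1, h2⟩
    refine ⟨p + n * j, ?_, ?_⟩ <;> push_cast <;> linarith

lemma mem_arc_iff {c β : ℝ} {n p : ℕ} (hn : 0 < n) :
    β ∈ arc c ⟨n, p⟩ ↔ 0 < n * β - (p : ℤ) ∧ n * β - (p : ℤ) ≤ c / n := by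
  have h : (0 : ℝ) < n := by exact_mod_cast hn
  simp only [arc, Set.mem_Ioc, Int.cast_natCast]
  refine and_congr ?_ ?_
  · rw [div_lt_iff₀ h, sub_pos, mul_comm]
  · rw [show (p : ℝ) / n + c / (n : ℝ) ^ 2 = (p + c / n) / n by field_simp, le_div_iff₀ h,
      sub_le_iff_le_add, mul_comm, add_comm]

lemma sum_indicator_arc {c : ℝ} {n : ℕ} (hn : 0 < n) (hcn : c ≤ n) {β : ℝ}
    (hβ : β ∈ Set.Ioc (0 : ℝ) 1) :
    ∑ p ∈ Finset.range n, (arc c ⟨n, p⟩).indicator (1 : ℝ → ℝ) β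
      = (approxSet c β).indicator (1 : ℕ → ℝ) n := by
  have h : (0 : ℝ) < n := by exact_mod_cast hn
  have hc1 : c / n ≤ 1 := (div_le_one h).2 hcn
  by_cases hmem : n ∈ approxSet c β
  · rw [Set.indicator_of_mem hmem]
    obtain ⟨-, p, h1, h2⟩ := hmem
    have hp0 : 0 ≤ p := by
      have : (-1 : ℝ) < p := by nlinarith [mul_pos h hβ.1]
      have : (-1 : ℤ) < p := by exact_mod_cast this
      omega
    have hpn : p < n := by
      have : (p : ℝ) < n := by nlinarith [hβ.2]
      exact_mod_cast this
    lift p to ℕ using hp0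
    rw [Finset.sum_eq_single p, Set.indicator_of_mem ((mem_arc_iff hn).2 ⟨h1, h2⟩)]
    · rfl
    · intro q _ hqp
      apply Set.indicator_of_notMem
      rw [mem_arc_iff hn]
      rintro ⟨h3, h4⟩
      apply hqp
      have e1 : ((q : ℤ) : ℝ) < (p : ℤ) + 1 := by linarith
      have e2 : ((p : ℤ) : ℝ) < (q : ℤ) + 1 := by linarith
      have e1' : (q : ℤ) < p + 1 := by exact_mod_cast e1
      have e2' : (p : ℤ) < q + 1 := by exact_mod_cast e2
      omega
    · intro hp
      exact absurd (Finset.mem_range.2 (by exact_mod_cast hpn)) hp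
  · rw [Set.indicator_of_notMem hmem]
    refine Finset.sum_eq_zero fun p _ => Set.indicator_of_notMem ?_ _
    rw [mem_arc_iff hn]
    exact fun hp => hmem ⟨hn, p, hp⟩

lemma hits_eq_ncard {c : ℝ} {k : ℕ} (hk : 0 < k) (hck : c ≤ k) (N : ℕ) {β : ℝ}
    (hβ : β ∈ Set.Ioc (0 : ℝ) 1) :
    hits c (fracs k N) β = ((approxSet c β ∩ Set.Icc k N).ncard : ℝ) := by
  classical
  rw [hits, fracs, Finset.sum_sigma]
  have h1 : ∀ n ∈ Finset.Icc k N,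
      ∑ p ∈ Finset.range n, (arc c ⟨n, p⟩).indicator (1 : ℝ → ℝ) β
        = if n ∈ approxSet c β then 1 else 0 := by
    intro n hn
    have hn' := (Finset.mem_Icc.1 hn).1
    rw [sum_indicator_arc (by omega) (hck.trans (by exact_mod_cast hn')) hβ, Set.indicator_apply]
    rfl
  rw [Finset.sum_congr rfl h1, Finset.sum_boole, ← Set.ncard_coe_finset]
  congr 2
  ext n
  simp [and_comm]

lemma finite_inter_Icc (S : Set ℕ) (a b : ℕ) : (S ∩ Set.Icc a b).Finite :=
  (Set.finite_Icc a b).subset Set.inter_subset_right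

lemma ncard_inter_Icc_le_add {S S' : Set ℕ} {k : ℕ} (h : ∀ n ∈ S, k ≤ n → n ∈ S') (N : ℕ) :
    (S ∩ Set.Icc 1 N).ncard ≤ (S' ∩ Set.Icc 1 N).ncard + k := by
  calc (S ∩ Set.Icc 1 N).ncard ≤ ((S' ∩ Set.Icc 1 N) ∪ Set.Iio k).ncard := by
        apply Set.ncard_le_ncard _ ((finite_inter_Icc _ _ _).union (Set.finite_Iio k))
        rintro n ⟨h1, h2⟩
        by_cases hk : k ≤ n
        · exact Or.inl ⟨h n h1 hk, h2⟩
        · exact Or.inr (not_le.1 hk)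
    _ ≤ _ := (Set.ncard_union_le _ _).trans (by simp [Set.ncard_eq_toFinset_card'])

lemma ae_tendsto_zero_of_summable_integral {α : Type*} [MeasurableSpace α] {μ : Measure α}
    {F : ℕ → α → ℝ} (hF : ∀ k, Integrable (F k) μ) (h0 : ∀ k x, 0 ≤ F k x)
    (hs : Summable fun k => ∫ x, F k x ∂μ) :
    ∀ᵐ x ∂μ, Tendsto (fun k => F k x) atTop (𝓝 0) := by
  have h1 : ∫⁻ x, ∑' k, ENNReal.ofReal (F k x) ∂μ ≠ ⊤ := by
    rw [lintegral_tsum fun k => (hF k).aestronglyMeasurable.aemeasurable.ennreal_ofReal]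
    simp_rw [← fun k => ofReal_integral_eq_lintegral_ofReal (hF k) (Eventually.of_forall (h0 k))]
    exact hs.tsum_ofReal_ne_top
  have h2 := ae_lt_top' (AEMeasurable.tsum
    fun k => (hF k).aestronglyMeasurable.aemeasurable.ennreal_ofReal) h1
  filter_upwards [h2] with x hx
  have h3 := ENNReal.tendsto_atTop_zero_of_tsum_ne_top hx.ne
  have h4 := (ENNReal.tendsto_toReal ENNReal.zero_ne_top).comp h3
  simpa [Function.comp_def, ENNReal.toReal_ofReal (h0 _ x)] using h4

lemma tendsto_div_log_of_subseq {f : ℕ → ℝ} (hf : Monotone f) (hf0 : ∀ n, 0 ≤ f n) {u : ℕ → ℕ}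
    (hu : StrictMono u) (hu0 : u 0 ≤ 1)
    (hlog : Tendsto (fun k => Real.log (u (k + 1)) / Real.log (u k)) atTop (𝓝 1)) {c : ℝ}
    (h : Tendsto (fun k => f (u k) / Real.log (u k)) atTop (𝓝 c)) :
    Tendsto (fun n : ℕ => f n / Real.log n) atTop (𝓝 c) := by
  let κ : ℕ → ℕ := fun n => Nat.findGreatest (fun k => u k ≤ n) n
  have hκ1 : ∀ n, 1 ≤ n → u (κ n) ≤ n := fun n hn =>
    Nat.findGreatest_spec (P := fun k => u k ≤ n) (Nat.zero_le n) (hu0.trans hn)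
  have hκ2 : ∀ n, n < u (κ n + 1) := by
    intro n
    by_contra! hle
    have : κ n + 1 ≤ κ n := Nat.le_findGreatest ((hu.id_le _).trans hle) hle
    omega
  have hκ : Tendsto κ atTop atTop := by
    refine tendsto_atTop.2 fun b => ?_
    filter_upwards [eventually_ge_atTop (u b)] with n hn
    exact Nat.le_findGreatest ((hu.id_le b).trans hn) hn
  have hlogpos : ∀ᶠ k in atTop, 0 < Real.log (u k) := by
    filter_upwards [eventually_ge_atTop 2] with k hk
    apply Real.log_pos
    have := hu.id_le k
    simp only [id] at this
    exact_mod_cast (by omega : 1 < u k)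
  have hlo : Tendsto (fun k => f (u k) / Real.log (u (k + 1))) atTop (𝓝 c) := by
    have := h.div hlog one_ne_zero
    rw [div_one] at this
    refine this.congr' ?_
    filter_upwards [hlogpos] with k hk
    simp only [Pi.div_apply]
    rw [div_div_div_cancel_right₀ hk.ne']
  have hhi : Tendsto (fun k => f (u (k + 1)) / Real.log (u k)) atTop (𝓝 c) := by
    have := (h.comp (tendsto_add_atTop_nat 1)).mul hlog
    rw [mul_one] at this
    refine this.congr' ?_
    filter_upwards [(tendsto_add_atTop_nat 1).eventually hlogpos] with k hk
    simp only [Function.comp]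
    rw [div_mul_div_cancel₀ hk.ne']
  refine tendsto_of_tendsto_of_tendsto_of_le_of_le' (hlo.comp hκ) (hhi.comp hκ) ?_ ?_
  · filter_upwards [hκ.eventually hlogpos, eventually_ge_atTop 1] with n hn h1
    have h2 : (0 : ℝ) < u (κ n) := by
      by_contra! h3
      have : (u (κ n) : ℝ) = 0 := le_antisymm h3 (Nat.cast_nonneg _)
      simp [this] at hn
    have h3 : Real.log (u (κ n)) ≤ Real.log n :=
      Real.log_le_log h2 (by exact_mod_cast hκ1 n h1)
    have h4 : Real.log n ≤ Real.log (u (κ n + 1)) :=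
      Real.log_le_log (by exact_mod_cast h1) (by exact_mod_cast (hκ2 n).le)
    exact div_le_div₀ (hf0 _) (hf (hκ1 n h1)) (by linarith) h4
  · filter_upwards [hκ.eventually hlogpos, eventually_ge_atTop 1] with n hn h1
    have h2 : (0 : ℝ) < u (κ n) := by
      by_contra! h3
      have : (u (κ n) : ℝ) = 0 := le_antisymm h3 (Nat.cast_nonneg _)
      simp [this] at hn
    have h3 : Real.log (u (κ n)) ≤ Real.log n :=
      Real.log_le_log h2 (by exact_mod_cast hκ1 n h1)
    exact div_le_div₀ (hf0 _) (hf (hκ2 n).le) hn h3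

lemma sum_Icc_one_div_eq_harmonic (N : ℕ) :
    ∑ n ∈ Finset.Icc 1 N, (1 : ℝ) / n = (harmonic N : ℝ) := by
  rw [harmonic_eq_sum_Icc]
  push_cast
  simp

lemma tendsto_sum_Icc_div_log {k : ℕ} (hk : 0 < k) :
    Tendsto (fun N : ℕ => (∑ n ∈ Finset.Icc k N, (1 : ℝ) / n) / Real.log N) atTop (𝓝 1) := by
  have hlog : Tendsto (fun N : ℕ => Real.log N) atTop atTop :=
    Real.tendsto_log_atTop.comp tendsto_natCast_atTop_atTop
  have h1 := (Real.tendsto_harmonic_sub_log.sub_const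
    (∑ n ∈ Finset.Ico 1 k, (1 : ℝ) / n)).div_atTop hlog
  have h2 := h1.add_const 1
  rw [zero_add] at h2
  refine h2.congr' ?_
  filter_upwards [eventually_ge_atTop k, hlog.eventually_gt_atTop 0] with N hN hpos
  have : ∑ n ∈ Finset.Ico 1 k, (1 : ℝ) / n + ∑ n ∈ Finset.Icc k N, (1 : ℝ) / n = harmonic N := by
    rw [← sum_Icc_one_div_eq_harmonic, ← Finset.Ico_add_one_right_eq_Icc,
      ← Finset.Ico_add_one_right_eq_Icc]
    exact Finset.sum_Ico_consecutive _ hk (by omega)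
  rw [← this]
  field_simp
  ring

lemma ae_hasLogGrowth_unit {c : ℝ} (hc : 0 < c) :
    ∀ᵐ β ∂volume.restrict (Set.Ioc (0 : ℝ) 1), HasLogGrowth (approxSet c β) c := by
  obtain ⟨k, hck⟩ : ∃ k : ℕ, c ≤ k := exists_nat_ge c
  have hk : 0 < k := by
    have : (0 : ℝ) < k := hc.trans_le hck
    exact_mod_cast this
  let u : ℕ → ℕ := fun j => 2 ^ j ^ 8
  have hlogu : ∀ j, Real.log (u j) = (j : ℝ) ^ 8 * Real.log 2 := by
    intro j
    simp only [u]
    push_cast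
    rw [Real.log_pow]
    push_cast
    rfl
  have hlog2 : 0 < Real.log 2 := Real.log_pos one_lt_two
  have hu : StrictMono u := fun i j hij =>
    Nat.pow_lt_pow_right one_lt_two (Nat.pow_lt_pow_left hij (by norm_num))
  let M : ℕ → ℝ := fun j => c * ∑ n ∈ Finset.Icc k (u j), (1 : ℝ) / n
  let F : ℕ → ℝ → ℝ := fun j β => |hits c (fracs k (u j)) β - M j| / (j : ℝ) ^ 8
  have hFint : ∀ j, Integrable (F j) (volume.restrict (Set.Ioc (0 : ℝ) 1)) := fun j =>
    (((integrable_hits c _).sub (integrable_const _)).abs).div_const _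
  have hbound : ∀ j : ℕ, ∫ β in Set.Ioc (0 : ℝ) 1, F j β ≤ (5 * c + 1 / 2) * (1 / (j : ℝ) ^ 2) := by
    intro j
    simp only [F]
    rw [integral_div]
    rcases Nat.eq_zero_or_pos j with rfl | hj
    · simp
    have hjR : (1 : ℝ) ≤ j := by exact_mod_cast hj
    have hj0 : (0 : ℝ) < j := by linarith
    set A := c * ∑ n ∈ Finset.Icc 1 (u j), (1 : ℝ) / n with hA
    have h1 := integral_abs_hits_sub_le hc hk hck (N := u j) (G := j ^ 4) (by positivity)
      (by positivity) (K := (j : ℝ) ^ 2) (by positivity) hA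
    have hA2 : A ≤ 2 * c * (j : ℝ) ^ 8 := by
      have h2 := harmonic_le_one_add_log (u j)
      rw [← sum_Icc_one_div_eq_harmonic, hlogu] at h2
      have h3 : (1 : ℝ) ≤ (j : ℝ) ^ 8 := one_le_pow₀ hjR
      have h4 : Real.log 2 ≤ 1 := by linarith [Real.log_two_lt_d9]
      have h5 : (j : ℝ) ^ 8 * Real.log 2 ≤ (j : ℝ) ^ 8 * 1 := by gcongr
      rw [hA, show 2 * c * (j : ℝ) ^ 8 = c * (2 * (j : ℝ) ^ 8) by ring]
      exact mul_le_mul_of_nonneg_left (by linarith) hc.le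
    have e1 : A / ((j ^ 4 : ℕ) : ℝ) ≤ 2 * c * (j : ℝ) ^ 4 := by
      push_cast
      rw [div_le_iff₀ (by positivity)]
      calc A ≤ _ := hA2
        _ = _ := by ring
    have e2 : A / (j : ℝ) ^ 2 ≤ 2 * c * (j : ℝ) ^ 6 := by
      rw [div_le_iff₀ (by positivity)]
      calc A ≤ _ := hA2
        _ = _ := by ring
    have e3 : (j : ℝ) ^ 2 * (((j ^ 4 : ℕ) : ℝ) + 2 * (A / ((j ^ 4 : ℕ) : ℝ)))
        ≤ (1 + 4 * c) * (j : ℝ) ^ 6 := by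
      calc _ ≤ (j : ℝ) ^ 2 * (((j ^ 4 : ℕ) : ℝ) + 2 * (2 * c * (j : ℝ) ^ 4)) := by gcongr
        _ = _ := by push_cast; ring
    have e4 : 2 * c * (j : ℝ) ^ 4 ≤ 2 * c * (j : ℝ) ^ 6 := by
      gcongr
      norm_num
    rw [div_le_iff₀ (by positivity)]
    calc _ ≤ _ := h1
      _ ≤ (5 * c + 1 / 2) * (j : ℝ) ^ 6 := by linarith
      _ = _ := by field_simp
  have hsum : Summable fun j => ∫ β in Set.Ioc (0 : ℝ) 1, F j β := by
    refine Summable.of_nonneg_of_le (fun j => integral_nonneg fun β => by positivity) hbound ?_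
    exact (Real.summable_one_div_nat_pow.2 one_lt_two).mul_left _
  have hMlim : Tendsto (fun j => M j / Real.log (u j)) atTop (𝓝 c) := by
    have := ((tendsto_sum_Icc_div_log hk).comp hu.tendsto_atTop).const_mul c
    rw [mul_one] at this
    refine this.congr fun j => ?_
    simp only [Function.comp, M, mul_div_assoc]
  have hloglim : Tendsto (fun j => Real.log (u (j + 1)) / Real.log (u j)) atTop (𝓝 1) := by
    have h1 : Tendsto (fun j : ℕ => (1 + 1 / (j : ℝ)) ^ 8) atTop (𝓝 ((1 + 0) ^ 8)) :=
      (tendsto_one_div_atTop_nhds_zero_nat.const_add 1).pow 8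
    norm_num at h1
    refine h1.congr' ?_
    filter_upwards [eventually_gt_atTop 0] with j hj
    have hj0 : (j : ℝ) ≠ 0 := by positivity
    rw [hlogu, hlogu]
    push_cast
    field_simp
  have hlogatTop : Tendsto (fun j => Real.log (u j)) atTop atTop :=
    Real.tendsto_log_atTop.comp (tendsto_natCast_atTop_atTop.comp hu.tendsto_atTop)
  filter_upwards [ae_tendsto_zero_of_summable_integral hFint (fun j β => by positivity) hsum,
    ae_restrict_mem measurableSet_Ioc] with β hβ hβ1
  refine tendsto_div_log_of_subseq (f := fun n => ((approxSet c β ∩ Set.Icc 1 n).ncard : ℝ))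
    ?_ (fun _ => Nat.cast_nonneg _) hu (by simp [u]) hloglim ?_
  · intro m n hmn
    have : (approxSet c β ∩ Set.Icc 1 m).ncard ≤ (approxSet c β ∩ Set.Icc 1 n).ncard :=
      Set.ncard_le_ncard (Set.inter_subset_inter_right _ (Set.Icc_subset_Icc_right hmn))
        (finite_inter_Icc _ _ _)
    exact Nat.cast_le.2 this
  · rw [tendsto_iff_norm_sub_tendsto_zero]
    have h1 : Tendsto (fun j => F j β / Real.log 2 + (k : ℝ) / Real.log (u j)
        + |M j / Real.log (u j) - c|) atTop (𝓝 0) := by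
      have h2 := (hβ.div_const (Real.log 2)).add (hlogatTop.const_div_atTop (k : ℝ))
      have h3 := (tendsto_iff_norm_sub_tendsto_zero.1 hMlim)
      simpa using h2.add h3
    refine squeeze_zero' (Eventually.of_forall fun _ => norm_nonneg _) ?_ h1
    filter_upwards [eventually_gt_atTop 0] with j hj
    have hj0 : (0 : ℝ) < j := by exact_mod_cast hj
    have hlpos : 0 < Real.log (u j) := by rw [hlogu]; positivity
    set w := ((approxSet c β ∩ Set.Icc 1 (u j)).ncard : ℝ) with hw
    set z := hits c (fracs k (u j)) β with hz
    have hz' := hits_eq_ncard hk hck (u j) hβ1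
    have hzw : z ≤ w := by
      rw [hz, hz', hw]
      have : (approxSet c β ∩ Set.Icc k (u j)).ncard ≤ (approxSet c β ∩ Set.Icc 1 (u j)).ncard :=
        Set.ncard_le_ncard (Set.inter_subset_inter_right _ (Set.Icc_subset_Icc_left hk))
          (finite_inter_Icc _ _ _)
      exact_mod_cast this
    have hwz : w ≤ z + k := by
      have h5 := ncard_inter_Icc_le_add (S := approxSet c β) (S' := approxSet c β ∩ Set.Ici k)
        (k := k) (fun n h1 h2 => ⟨h1, h2⟩) (u j)
      have h6 : ((approxSet c β ∩ Set.Ici k) ∩ Set.Icc 1 (u j)).ncard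
          ≤ (approxSet c β ∩ Set.Icc k (u j)).ncard :=
        Set.ncard_le_ncard (fun n hn => ⟨hn.1.1, hn.1.2, hn.2.2⟩) (finite_inter_Icc _ _ _)
      rw [hz, hz', hw]
      exact_mod_cast h5.trans (Nat.add_le_add_right h6 k)
    have hF : F j β / Real.log 2 = |z - M j| / Real.log (u j) := by
      rw [hlogu, ← div_div]
    rw [hF, Real.norm_eq_abs]
    calc |w / Real.log (u j) - c|
        = |(z - M j) / Real.log (u j) + (w - z) / Real.log (u j) + (M j / Real.log (u j) - c)| := by
          congr 1; ring
      _ ≤ |(z - M j) / Real.log (u j)| + |(w - z) / Real.log (u j)|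
          + |M j / Real.log (u j) - c| := abs_add_three _ _ _
      _ ≤ _ := by
          rw [abs_div, abs_div, abs_of_pos hlpos, abs_of_nonneg (sub_nonneg.2 hzw)]
          gcongr
          linarith

/-- For almost every `β`, the counting function of `approxSet c β` is asymptotic to `c log n`. -/
lemma ae_hasLogGrowth {c : ℝ} (hc : 0 < c) :
    ∀ᵐ β : ℝ, HasLogGrowth (approxSet c β) c := by
  have h := (ae_restrict_iff' measurableSet_Ioc).1 (ae_hasLogGrowth_unit hc)
  have h2 : ∀ j : ℤ, ∀ᵐ β : ℝ, β + j ∈ Set.Ioc (0 : ℝ) 1 →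
      HasLogGrowth (approxSet c (β + j)) c := fun j =>
    (measurePreserving_add_right volume (j : ℝ)).quasiMeasurePreserving.ae h
  filter_upwards [ae_all_iff.2 h2] with β hβ
  have h3 := hβ (1 - ⌈β⌉) ⟨?_, ?_⟩
  · rwa [approxSet_add_int] at h3
  · push_cast; linarith [Int.ceil_lt_add_one β]
  · push_cast; linarith [Int.le_ceil β]

lemma tendsto_const_div_log (k : ℝ) :
    Tendsto (fun n : ℕ => k / Real.log n) atTop (𝓝 0) :=
  (Real.tendsto_log_atTop.comp tendsto_natCast_atTop_atTop).const_div_atTop k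

lemma eventually_log_pos : ∀ᶠ n : ℕ in atTop, 0 < Real.log n :=
  (Real.tendsto_log_atTop.comp tendsto_natCast_atTop_atTop).eventually_gt_atTop 0

/-- A set squeezed, up to finitely many elements, between sets of logarithmic growth with constants
arbitrarily close to `c`, has logarithmic growth with constant `c`. -/
lemma HasLogGrowth.of_sandwich {S : Set ℕ} {c : ℝ}
    (hlo : ∀ a < c, ∃ S' : Set ℕ, ∃ a' > a, HasLogGrowth S' a' ∧ ∀ᶠ n in atTop, n ∈ S' → n ∈ S)
    (hhi : ∀ b > c, ∃ S' : Set ℕ, ∃ b' < b, HasLogGrowth S' b' ∧ ∀ᶠ n in atTop, n ∈ S → n ∈ S') :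
    HasLogGrowth S c := by
  refine tendsto_order.2 ⟨fun a ha => ?_, fun b hb => ?_⟩
  · obtain ⟨S', a', haa', hS', hsub⟩ := hlo a ha
    obtain ⟨k, hk⟩ := eventually_atTop.1 hsub
    have h1 : Tendsto _ atTop (𝓝 (a' - 0)) := Tendsto.sub hS' (tendsto_const_div_log k)
    rw [sub_zero] at h1
    filter_upwards [h1.eventually_const_lt haa', eventually_log_pos] with n hn hpos
    refine hn.trans_le ?_
    rw [← sub_div]
    refine div_le_div_of_nonneg_right ?_ hpos.le
    have := ncard_inter_Icc_le_add (S := S') (S' := S) (k := k) (fun n h1 h2 => hk n h2 h1) n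
    have : ((S' ∩ Set.Icc 1 n).ncard : ℝ) ≤ (S ∩ Set.Icc 1 n).ncard + k := by exact_mod_cast this
    linarith
  · obtain ⟨S', b', hbb', hS', hsub⟩ := hhi b hb
    obtain ⟨k, hk⟩ := eventually_atTop.1 hsub
    have h1 : Tendsto _ atTop (𝓝 (b' + 0)) := Tendsto.add hS' (tendsto_const_div_log k)
    rw [add_zero] at h1
    filter_upwards [h1.eventually_lt_const hbb', eventually_log_pos] with n hn hpos
    refine lt_of_le_of_lt ?_ hn
    rw [← add_div]
    refine div_le_div_of_nonneg_right ?_ hpos.le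
    have := ncard_inter_Icc_le_add (S := S) (S' := S') (k := k) (fun n h1 h2 => hk n h2 h1) n
    exact_mod_cast this

lemma HasLogGrowth.diff {S T : Set ℕ} {s t : ℝ} (hS : HasLogGrowth S s) (hT : HasLogGrowth T t)
    (hTS : ∀ᶠ n in atTop, n ∈ T → n ∈ S) : HasLogGrowth (S \ T) (s - t) := by
  obtain ⟨k, hk⟩ := eventually_atTop.1 hTS
  have h1 : Tendsto _ atTop (𝓝 (s - t)) := Tendsto.sub hS hT
  have h2 := h1.add (tendsto_const_div_log k)
  rw [add_zero] at h2
  refine tendsto_of_tendsto_of_tendsto_of_le_of_le' h1 h2 ?_ ?_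
  all_goals
    filter_upwards [eventually_log_pos] with n hpos
    have e : ((S \ T) ∩ Set.Icc 1 n) = (S ∩ Set.Icc 1 n) \ (T ∩ Set.Icc 1 n) := by
      ext m; simp only [Set.mem_inter_iff, Set.mem_sdiff]; tauto
    have e1 : (S ∩ Set.Icc 1 n).ncard ≤ ((S \ T) ∩ Set.Icc 1 n).ncard + (T ∩ Set.Icc 1 n).ncard := by
      rw [e]
      have := Set.ncard_le_ncard_sdiff_add_ncard (S ∩ Set.Icc 1 n) (T ∩ Set.Icc 1 n)
        (finite_inter_Icc _ _ _)
      exact this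
    have e2 : ((S \ T) ∩ Set.Icc 1 n).ncard + (T ∩ Set.Icc 1 n).ncard
        ≤ (S ∩ Set.Icc 1 n).ncard + k := by
      rw [← Set.ncard_union_eq _ (finite_inter_Icc _ _ _) (finite_inter_Icc _ _ _)]
      · rw [← Set.union_inter_distrib_right]
        refine ncard_inter_Icc_le_add (S := (S \ T) ∪ T) (S' := S) (fun n h1 h2 => ?_) n
        rcases h1 with h1 | h1
        · exact h1.1
        · exact hk n h2 h1
      · rw [Set.disjoint_left]
        exact fun m h1 h2 => h1.1.2 h2.1
    have e1' : ((S ∩ Set.Icc 1 n).ncard : ℝ)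
        ≤ ((S \ T) ∩ Set.Icc 1 n).ncard + (T ∩ Set.Icc 1 n).ncard := by exact_mod_cast e1
    have e2' : (((S \ T) ∩ Set.Icc 1 n).ncard : ℝ) + (T ∩ Set.Icc 1 n).ncard
        ≤ (S ∩ Set.Icc 1 n).ncard + k := by exact_mod_cast e2
    simp only [← sub_div, ← add_div]
    exact div_le_div_of_nonneg_right (by linarith) hpos.le

/-- The `n ≥ 1` for which `n * α` is less than a half-integer by at most `c / n`. -/
def halfApproxSet (c α : ℝ) : Set ℕ :=
  {n | 0 < n ∧ ∃ m : ℤ, n * α - 1 / 2 < m ∧ m ≤ n * α - 1 / 2 + c / n}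

lemma eventually_mul_div_lt_one (c : ℝ) : ∀ᶠ n : ℕ in atTop, c / n < 1 :=
  (tendsto_const_div_atTop_nhds_zero_nat c).eventually_lt_const one_pos

lemma halfApproxSet_iff {c α : ℝ} {n : ℕ} (h : 2 * c / n < 1) :
    n ∈ halfApproxSet c α ↔ n ∈ approxSet (2 * c) (2 * -α) \ approxSet c (-α) := by
  have hdiv : 2 * c / (n : ℝ) = 2 * (c / n) := by ring
  rw [hdiv] at h
  constructor
  · rintro ⟨hn, m, h1, h2⟩
    refine ⟨⟨hn, -(2 * m + 1), ?_, ?_⟩, ?_⟩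
    · push_cast; linarith
    · rw [hdiv]; push_cast; linarith
    · rintro ⟨-, q, h3, h4⟩
      have e1 : (-(2 * m + 1) : ℝ) < 2 * q + 1 := by linarith
      have e2 : (2 * q : ℝ) < -(2 * m + 1) + 1 := by linarith
      have e1' : -(2 * m + 1) < 2 * q + 1 := by exact_mod_cast e1
      have e2' : 2 * q < -(2 * m + 1) + 1 := by exact_mod_cast e2
      omega
  · rintro ⟨⟨hn, p, h1, h2⟩, h3⟩
    rw [hdiv] at h2
    rcases Int.even_or_odd' p with ⟨q, rfl | rfl⟩
    · refine absurd ⟨hn, q, ?_, ?_⟩ h3 <;> push_cast at h1 h2 <;> linarith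
    · refine ⟨hn, -q - 1, ?_, ?_⟩ <;> push_cast at h1 h2 ⊢ <;> linarith

lemma approxSet_subset_two_mul {c β : ℝ} : approxSet c β ⊆ approxSet (2 * c) (2 * β) := by
  rintro n ⟨hn, p, h1, h2⟩
  refine ⟨hn, 2 * p, ?_, ?_⟩
  · push_cast; linarith
  · rw [mul_div_assoc]; push_cast; linarith

lemma HasLogGrowth.congr {S T : Set ℕ} {c : ℝ} (hS : HasLogGrowth S c)
    (h : ∀ᶠ n in atTop, n ∈ S ↔ n ∈ T) : HasLogGrowth T c := by
  refine .of_sandwich (fun a ha => ⟨S, c, ha, hS, ?_⟩) (fun b hb => ⟨S, c, hb, hS, ?_⟩)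
  · filter_upwards [h] with n hn using hn.1
  · filter_upwards [h] with n hn using hn.2

lemma hasLogGrowth_halfApproxSet {c α : ℝ} (h1 : HasLogGrowth (approxSet c (-α)) c)
    (h2 : HasLogGrowth (approxSet (2 * c) (2 * -α)) (2 * c)) :
    HasLogGrowth (halfApproxSet c α) c := by
  have h3 := h2.diff h1 (Eventually.of_forall fun n hn => approxSet_subset_two_mul hn)
  rw [show 2 * c - c = c by ring] at h3
  refine h3.congr ?_
  filter_upwards [eventually_mul_div_lt_one (2 * c)] with n hn
  exact (halfApproxSet_iff hn).symm

lemma tendsto_inv_exp_sub_one :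
    Tendsto (fun x : ℝ => ((Real.exp x - 1)⁻¹ - (x⁻¹ - 1 / 2)) / x) (𝓝[>] 0) (𝓝 (1 / 12)) := by
  let q : ℝ → ℝ := fun x => (Real.exp x - 1 - x - x ^ 2 / 2 - x ^ 3 / 6) / x ^ 3
  have hx0 : Tendsto (fun x : ℝ => x) (𝓝[>] 0) (𝓝 0) := tendsto_nhdsWithin_of_tendsto_nhds tendsto_id
  have hmem : ∀ᶠ x : ℝ in 𝓝[>] 0, x ∈ Set.Ioo (0 : ℝ) 1 := Ioo_mem_nhdsGT one_pos
  have hq : Tendsto q (𝓝[>] 0) (𝓝 0) := by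
    rw [tendsto_zero_iff_norm_tendsto_zero]
    refine squeeze_zero' (Eventually.of_forall fun _ => norm_nonneg _) ?_ hx0
    filter_upwards [hmem] with x hx
    have h := Real.exp_bound (x := x) (by rw [abs_of_pos hx.1]; exact hx.2.le) (n := 4) (by norm_num)
    simp only [Finset.sum_range_succ, Finset.sum_range_zero] at h
    norm_num [Nat.factorial] at h
    rw [abs_of_pos hx.1] at h
    simp only [q]
    rw [Real.norm_eq_abs, abs_div, abs_of_pos (pow_pos hx.1 3), div_le_iff₀ (pow_pos hx.1 3)]
    rw [show Real.exp x - 1 - x - x ^ 2 / 2 - x ^ 3 / 6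
      = Real.exp x - (1 + x + x ^ 2 / 2 + x ^ 3 / 6) by ring]
    refine h.trans ?_
    have := pow_pos hx.1 4
    nlinarith
  have hlim : Tendsto (fun x : ℝ => (1 / 6 + x / 6 + (x - 2) * q x)
      / (2 * (1 + x / 2 + x ^ 2 / 6 + x ^ 2 * q x))) (𝓝[>] 0)
      (𝓝 ((1 / 6 + 0 / 6 + (0 - 2) * 0) / (2 * (1 + 0 / 2 + 0 ^ 2 / 6 + 0 ^ 2 * 0)))) := by
    refine Tendsto.div ?_ ?_ (by norm_num)
    · exact ((hx0.div_const 6).const_add _).add ((hx0.sub_const 2).mul hq)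
    · exact ((((hx0.div_const 2).const_add 1).add ((hx0.pow 2).div_const 6)).add
        ((hx0.pow 2).mul hq)).const_mul 2
  norm_num at hlim
  norm_num
  refine hlim.congr' ?_
  filter_upwards [hmem] with x hx
  have hx' : x ≠ 0 := hx.1.ne'
  have hE : Real.exp x - 1 ≠ 0 := by
    have := Real.add_one_lt_exp hx'
    linarith [hx.1]
  have hE2 : 1 + x / 2 + x ^ 2 / 6 + x ^ 2 * q x = (Real.exp x - 1) / x := by
    simp only [q]; field_simp; ring
  rw [hE2]
  simp only [q]
  field_simp
  ring

lemma tendsto_mul_inv_rpow_sub {θ : ℝ} (hθ : 1 < θ) :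
    Tendsto (fun n : ℕ => n * ((θ ^ ((n : ℝ))⁻¹ - 1)⁻¹ - ((n : ℝ) / Real.log θ - 1 / 2))) atTop
      (𝓝 (Real.log θ / 12)) := by
  have hL : 0 < Real.log θ := Real.log_pos hθ
  have hx : Tendsto (fun n : ℕ => Real.log θ / n) atTop (𝓝[>] 0) := by
    refine tendsto_nhdsWithin_iff.2 ⟨tendsto_const_div_atTop_nhds_zero_nat _, ?_⟩
    filter_upwards [eventually_gt_atTop 0] with n hn
    have : (0 : ℝ) < n := by exact_mod_cast hn
    exact div_pos hL this
  have h := (tendsto_inv_exp_sub_one.comp hx).const_mul (Real.log θ)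
  rw [show Real.log θ * (1 / 12) = Real.log θ / 12 by ring] at h
  refine h.congr' ?_
  filter_upwards [eventually_gt_atTop 0] with n hn
  have hn' : (0 : ℝ) < n := by exact_mod_cast hn
  simp only [Function.comp]
  rw [Real.rpow_def_of_pos (by linarith), ← div_eq_mul_inv, inv_div]
  field_simp

lemma hasLogGrowth_Atheta {θ : ℝ} (hθ : 1 < θ)
    (h : ∀ c : ℚ, 0 < c → HasLogGrowth (halfApproxSet c (Real.log θ)⁻¹) c) :
    HasLogGrowth (Atheta θ) (Real.log θ / 12) := by
  have hL : 0 < Real.log θ := Real.log_pos hθ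
  have hlim := tendsto_mul_inv_rpow_sub hθ
  have hmem : ∀ᶠ n : ℕ in atTop, n ∈ Atheta θ ↔
      ∃ m : ℤ, n * (Real.log θ)⁻¹ - 1 / 2 < m ∧ (m : ℝ) ≤ (θ ^ ((n : ℝ))⁻¹ - 1)⁻¹ := by
    filter_upwards [hlim.eventually_const_lt (by positivity : (0 : ℝ) < _),
      eventually_gt_atTop 0] with n hn hn0
    have hlt : (n : ℝ) / Real.log θ - 1 / 2 < (θ ^ ((n : ℝ))⁻¹ - 1)⁻¹ := by
      have := pos_of_mul_pos_right hn (Nat.cast_nonneg n)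
      linarith
    rw [← div_eq_mul_inv]
    constructor
    · rintro ⟨-, hne⟩
      refine ⟨_, Int.floor_lt.1 (lt_of_le_of_ne (Int.floor_le_floor hlt.le) hne.symm),
        Int.floor_le _⟩
    · rintro ⟨m, h1, h2⟩
      exact ⟨hn0, ((Int.floor_lt.2 h1).trans_le (Int.le_floor.2 h2)).ne'⟩
  refine .of_sandwich (fun a ha => ?_) (fun b hb => ?_)
  · obtain ⟨c, hc1, hc2⟩ := exists_rat_btwn (max_lt ha (by positivity : 0 < Real.log θ / 12))
    have hc0 : (0 : ℚ) < c := by exact_mod_cast (le_max_right _ _).trans_lt hc1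
    refine ⟨_, c, (le_max_left _ _).trans_lt hc1, h c hc0, ?_⟩
    filter_upwards [hmem, hlim.eventually_const_lt hc2, eventually_gt_atTop 0] with n h1 h2 h3
    have h3' : (0 : ℝ) < n := by exact_mod_cast h3
    rintro ⟨-, m, h4, h5⟩
    refine h1.2 ⟨m, h4, h5.trans ?_⟩
    rw [mul_comm, ← div_lt_iff₀ h3', div_eq_mul_inv (n : ℝ)] at h2
    linarith
  · obtain ⟨c, hc1, hc2⟩ := exists_rat_btwn hb
    have hc0 : (0 : ℚ) < c := by
      exact_mod_cast (by positivity : 0 < Real.log θ / 12).trans hc1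
    refine ⟨_, c, hc2, h c hc0, ?_⟩
    filter_upwards [hmem, hlim.eventually_lt_const hc1, eventually_gt_atTop 0] with n h1 h2 h3 h4
    have h3' : (0 : ℝ) < n := by exact_mod_cast h3
    obtain ⟨m, h5, h6⟩ := h1.1 h4
    refine ⟨h3, m, h5, h6.trans ?_⟩
    rw [mul_comm, ← lt_div_iff₀ h3', div_eq_mul_inv (n : ℝ)] at h2
    linarith

lemma ae_hasLogGrowth_halfApproxSet :
    ∀ᵐ α : ℝ, ∀ c : ℚ, 0 < c → HasLogGrowth (halfApproxSet c α) c := by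
  refine ae_all_iff.2 fun c => ?_
  by_cases hc : 0 < c
  · have hcR : (0 : ℝ) < c := by exact_mod_cast hc
    have h1 := (Measure.measurePreserving_neg (volume : Measure ℝ)).quasiMeasurePreserving.ae
      (ae_hasLogGrowth hcR)
    have h2 := (Measure.quasiMeasurePreserving_smul (volume : Measure ℝ)
      (by norm_num : (-2 : ℝ) ≠ 0)).ae (ae_hasLogGrowth (mul_pos two_pos hcR))
    filter_upwards [h1, h2] with α h3 h4 _
    refine hasLogGrowth_halfApproxSet h3 ?_
    simpa using h4
  · exact Eventually.of_forall fun α h => absurd h hc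

/-- For almost all `θ > 1`, `|A_θ ∩ [1,n]| ∼ (log θ / 12) · log n`. -/
theorem stmt3 :
    MeasureTheory.volume
      {θ : ℝ | 1 < θ ∧
        ¬ Filter.Tendsto
            (fun n : ℕ => ((Atheta θ ∩ Set.Icc 1 n).ncard : ℝ) / Real.log n)
            Filter.atTop (nhds (Real.log θ / 12))} = 0 := by
  set B : Set ℝ := {α | ¬ ∀ c : ℚ, 0 < c → HasLogGrowth (halfApproxSet c α) c} with hB
  have hB0 : volume (B ∩ Set.Ioi 0) = 0 :=
    measure_mono_null Set.inter_subset_left (ae_iff.1 ae_hasLogGrowth_halfApproxSet)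
  have himg : volume ((fun α : ℝ => Real.exp α⁻¹) '' (B ∩ Set.Ioi 0)) = 0 := by
    refine addHaar_image_eq_zero_of_differentiableOn_of_addHaar_eq_zero volume ?_ hB0
    intro α hα
    exact (differentiableAt_inv (ne_of_gt hα.2)).exp.differentiableWithinAt
  refine measure_mono_null ?_ himg
  rintro θ ⟨hθ, hnot⟩
  refine ⟨(Real.log θ)⁻¹, ⟨fun h => hnot (hasLogGrowth_Atheta hθ h),
    inv_pos.2 (Real.log_pos hθ)⟩, ?_⟩
  simp only [inv_inv]
  exact Real.exp_log (by linarith)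
end

section
/- Let ℓ be an irrational real number whose simple continued fraction expansion ℓ = [a₀; a₁, a₂, …] has positive integer partial quotients satisfying a_{2k} = 1 for all k ≥ 0, and set θ = e^{2/ℓ}. Then A_θ is empty; equivalently, ⌊1/(θ^{1/n} − 1)⌋ = ⌊n/log θ − 1/2⌋ for every positive integer n. -/
/-- The iterates of the continued fraction (Gauss) algorithm on `ℓ`:
`x₀ = ℓ`, `x_{k+1} = 1/{x_k}`. -/
noncomputable def cfX (ℓ : ℝ) : ℕ → ℝ
  | 0 => ℓ
  | k + 1 => (Int.fract (cfX ℓ k))⁻¹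

/-- The `k`-th partial quotient of the simple continued fraction of `ℓ`:
`a_k = ⌊x_k⌋`, so `ℓ = [a₀; a₁, a₂, …]`. -/
noncomputable def cfA (ℓ : ℝ) (k : ℕ) : ℤ := ⌊cfX ℓ k⌋

theorem Real.two_mul_exp_sub_one_le {x : ℝ} (hx : 0 ≤ x) :
    2 * (Real.exp x - 1) ≤ x * (Real.exp x + 1) := by
  have hd (t : ℝ) : HasDerivAt (fun t : ℝ => t * (Real.exp t + 1) - 2 * (Real.exp t - 1))
      (1 * (Real.exp t + 1) + t * Real.exp t - 2 * Real.exp t) t :=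
    ((hasDerivAt_id t).mul ((Real.hasDerivAt_exp t).add_const 1)).sub
      (((Real.hasDerivAt_exp t).sub_const 1).const_mul 2)
  have hm : MonotoneOn (fun t : ℝ => t * (Real.exp t + 1) - 2 * (Real.exp t - 1)) (Set.Ici 0) := by
    refine monotoneOn_of_deriv_nonneg (convex_Ici 0)
      (fun t _ => (hd t).continuousAt.continuousWithinAt)
      (fun t _ => (hd t).differentiableAt.differentiableWithinAt) fun t _ => ?_
    rw [(hd t).deriv]
    have h1 := mul_le_mul_of_nonneg_left (Real.add_one_le_exp (-t)) (Real.exp_pos t).le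
    rw [← Real.exp_add, add_neg_cancel, Real.exp_zero] at h1
    linarith
  have := hm (Set.mem_Ici.2 le_rfl) (Set.mem_Ici.2 hx) hx
  simp only [Real.exp_zero] at this
  linarith

theorem Real.sq_add_six_mul_add_twelve_le_exp_mul {x : ℝ} (hx : 0 ≤ x) :
    x ^ 2 + 6 * x + 12 ≤ Real.exp x * (x ^ 2 - 6 * x + 12) := by
  have hneg (t : ℝ) : 0 < t ^ 2 - 6 * t + 12 := by nlinarith [sq_nonneg (t - 3)]
  have hpos (t : ℝ) : 0 < t ^ 2 + 6 * t + 12 := by nlinarith [sq_nonneg (t + 3)]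
  let h : ℝ → ℝ := fun t => t + Real.log (t ^ 2 - 6 * t + 12) - Real.log (t ^ 2 + 6 * t + 12)
  have hd (t : ℝ) : HasDerivAt h
      (1 + (2 * t - 6) / (t ^ 2 - 6 * t + 12) - (2 * t + 6) / (t ^ 2 + 6 * t + 12)) t := by
    have h1 : HasDerivAt (fun t : ℝ => t ^ 2 - 6 * t + 12) (2 * t - 6) t := by
      simpa using ((hasDerivAt_pow 2 t).sub ((hasDerivAt_id t).const_mul 6)).add_const 12
    have h2 : HasDerivAt (fun t : ℝ => t ^ 2 + 6 * t + 12) (2 * t + 6) t := by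
      simpa using ((hasDerivAt_pow 2 t).add ((hasDerivAt_id t).const_mul 6)).add_const 12
    exact ((hasDerivAt_id t).add (h1.log (hneg t).ne')).sub (h2.log (hpos t).ne')
  have hm : MonotoneOn h (Set.Ici 0) := by
    refine monotoneOn_of_deriv_nonneg (convex_Ici 0)
      (fun t _ => (hd t).continuousAt.continuousWithinAt)
      (fun t _ => (hd t).differentiableAt.differentiableWithinAt) fun t _ => ?_
    rw [(hd t).deriv]
    have hn := hneg t
    have hp := hpos t
    have : 1 + (2 * t - 6) / (t ^ 2 - 6 * t + 12) - (2 * t + 6) / (t ^ 2 + 6 * t + 12)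
        = t ^ 4 / ((t ^ 2 - 6 * t + 12) * (t ^ 2 + 6 * t + 12)) := by
      rw [one_add_div hn.ne', div_sub_div _ _ hn.ne' hp.ne']
      congr 1
      ring
    rw [this]
    positivity
  have h0 := hm (Set.mem_Ici.2 le_rfl) (Set.mem_Ici.2 hx) hx
  have h1 : Real.log (x ^ 2 + 6 * x + 12) ≤ x + Real.log (x ^ 2 - 6 * x + 12) := by
    simp only [h] at h0
    norm_num at h0
    linarith
  rw [Real.log_le_iff_le_exp (hpos x), Real.exp_add, Real.exp_log (hneg x)] at h1
  exact h1

theorem Real.le_inv_exp_sub_one {x : ℝ} (hx : 0 < x) :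
    1 / x - 1 / 2 ≤ (Real.exp x - 1)⁻¹ := by
  have he : 0 < Real.exp x - 1 := by linarith [Real.add_one_lt_exp hx.ne']
  rw [← sub_nonneg]
  have : (Real.exp x - 1)⁻¹ - (1 / x - 1 / 2) =
      (x * (Real.exp x + 1) - 2 * (Real.exp x - 1)) / (2 * x * (Real.exp x - 1)) := by
    field_simp
    ring
  rw [this]
  exact div_nonneg (sub_nonneg.2 (Real.two_mul_exp_sub_one_le hx.le)) (by positivity)

theorem Real.inv_exp_sub_one_le {x : ℝ} (hx : 0 < x) :
    (Real.exp x - 1)⁻¹ ≤ 1 / x - 1 / 2 + x / 12 := by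
  have he : 0 < Real.exp x - 1 := by linarith [Real.add_one_lt_exp hx.ne']
  rw [← sub_nonneg]
  have : 1 / x - 1 / 2 + x / 12 - (Real.exp x - 1)⁻¹ =
      (Real.exp x * (x ^ 2 - 6 * x + 12) - (x ^ 2 + 6 * x + 12)) /
        (12 * x * (Real.exp x - 1)) := by
    field_simp
    ring
  rw [this]
  exact div_nonneg (sub_nonneg.2 (Real.sq_add_six_mul_add_twelve_le_exp_mul hx.le))
    (by positivity)

theorem irrational_cfX {ℓ : ℝ} (hirr : Irrational ℓ) (k : ℕ) : Irrational (cfX ℓ k) := by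
  induction k with
  | zero => exact hirr
  | succ k ih =>
    rw [cfX, Int.fract]
    exact (ih.sub_intCast _).inv

theorem cfX_eq {ℓ : ℝ} (k : ℕ) : cfX ℓ k = cfA ℓ k + (cfX ℓ (k + 1))⁻¹ := by
  rw [cfX, inv_inv, cfA, Int.floor_add_fract]

theorem one_lt_cfX_succ {ℓ : ℝ} (hirr : Irrational ℓ) (k : ℕ) : 1 < cfX ℓ (k + 1) := by
  rw [cfX]
  have h : Int.fract (cfX ℓ k) ≠ 0 := by
    rw [Int.fract]
    exact ((irrational_cfX hirr k).sub_intCast _).ne_zero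
  exact (one_lt_inv₀ ((Int.fract_nonneg _).lt_of_ne' h)).2 (Int.fract_lt_one _)

/-- A concave quadratic in `w` dominates the chord joining its values at `0` and `a * u`. -/
theorem third_lt_of_endpoints {Q Q' d d' a u w : ℝ} (hQ' : 0 < Q') (hd' : 0 < d') (ha : 0 < a)
    (hu : 1 ≤ u) (hw : 0 ≤ w) (hwa : w ≤ a * u) (h0 : 1 / 3 < Q * d)
    (h1 : 1 / 3 < (Q + a * Q') * (d - a * d')) :
    1 / 3 < (u * Q + w * Q') * (u * d - w * d') := by
  have hau : 0 < a * u := by positivity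
  have key : (a * u) * ((u * Q + w * Q') * (u * d - w * d')) =
      u ^ 2 * ((a * u - w) * (Q * d) + w * ((Q + a * Q') * (d - a * d')))
        + a * u * (w * (a * u - w) * (Q' * d')) := by
    ring
  have hnn : 0 ≤ a * u * (w * (a * u - w) * (Q' * d')) := by
    have := sub_nonneg.2 hwa
    positivity
  have hchord : (a * u) * (1 / 3) <
      (a * u - w) * (Q * d) + w * ((Q + a * Q') * (d - a * d')) := by
    rcases hw.eq_or_lt with rfl | hw
    · simpa using mul_lt_mul_of_pos_left h0 hau
    · nlinarith [mul_le_mul_of_nonneg_left h0.le (sub_nonneg.2 hwa),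
        mul_lt_mul_of_pos_left h1 hw]
  have hu2 : 1 ≤ u ^ 2 := by nlinarith
  refine lt_of_mul_lt_mul_left ?_ hau.le
  rw [key]
  nlinarith [mul_nonneg (sub_nonneg.2 hu2) ((mul_pos hau (by norm_num)).trans hchord).le]

/-- For consecutive denominators `Q, Q'` with signed errors `d, d'` normalised by
`Q * d' + Q' * d = 1`, a bounded ratio of denominators bounds `Q * d` from below. -/
theorem third_lt_mul_of_le_two_mul {Q Q' d d' : ℝ} (hQ : 0 < Q) (hd' : 0 < d') (hd : d' < d)
    (hQ' : Q' ≤ 2 * Q) (hdet : Q * d' + Q' * d = 1) : 1 / 3 < Q * d := by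
  nlinarith [mul_lt_mul_of_pos_left hd hQ, mul_le_mul_of_nonneg_right hQ' (hd'.trans hd).le]

theorem cfX_odd_step {ℓ : ℝ} (hirr : Irrational ℓ) (heven : ∀ k : ℕ, cfA ℓ (2 * k) = 1)
    (j : ℕ) {d' : ℝ} (hd' : 0 < d') :
    let y := cfX ℓ (2 * j + 1)
    let a : ℝ := cfA ℓ (2 * j + 1)
    let e := y * d' - a * d'
    0 < d' - e ∧ e = cfX ℓ (2 * (j + 1) + 1) * (d' - e) := by
  intro y a e
  have hx : cfX ℓ (2 * j + 1) = _ := cfX_eq (2 * j + 1)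
  have hz : cfX ℓ (2 * (j + 1)) = _ := cfX_eq (2 * (j + 1))
  have hx1 := one_lt_cfX_succ hirr (2 * j + 1)
  have hz1 := one_lt_cfX_succ hirr (2 * (j + 1))
  rw [heven] at hz
  have he : e = d' / cfX ℓ (2 * (j + 1)) := by
    simp only [e, y, a]
    nth_rewrite 1 [hx]
    rw [add_mul, add_sub_cancel_left, mul_comm, div_eq_mul_inv]
    rfl
  have hpx : 0 < cfX ℓ (2 * (j + 1)) := zero_lt_one.trans hx1
  have hpz : 0 < cfX ℓ (2 * (j + 1) + 1) := zero_lt_one.trans hz1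
  constructor
  · rw [he, sub_pos]
    exact div_lt_self hd' hx1
  · rw [he, hz]
    push_cast
    field_simp
    ring

theorem one_lt_of_cfA_zero {ℓ : ℝ} (hirr : Irrational ℓ) (h : cfA ℓ 0 = 1) : 1 < ℓ := by
  have h1 : ((1 : ℤ) : ℝ) ≤ ℓ := Int.le_floor.1 (show 1 ≤ cfA ℓ 0 from h.ge)
  push_cast at h1
  exact h1.lt_of_ne' hirr.ne_one

/-- `Q, Q'` are consecutive convergent denominators and `d'` is the error of the latter,
the next complete quotient being `cfX ℓ (2 * j + 1)`. -/
structure IsOddState (ℓ : ℝ) (j : ℕ) (Q Q' d' : ℝ) : Prop where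
  nonneg : 0 ≤ Q
  pos : 0 < Q'
  error_pos : 0 < d'
  det : Q * d' + Q' * (cfX ℓ (2 * j + 1) * d') = 1

theorem IsOddState.next {ℓ : ℝ} (hirr : Irrational ℓ) (hpos : ∀ k : ℕ, 1 ≤ k → 0 < cfA ℓ k)
    (heven : ∀ k : ℕ, cfA ℓ (2 * k) = 1) {j : ℕ} {Q Q' d' a e : ℝ} (h : IsOddState ℓ j Q Q' d')
    (ha : a = cfA ℓ (2 * j + 1)) (he : e = cfX ℓ (2 * j + 1) * d' - a * d') :
    IsOddState ℓ (j + 1) (Q + a * Q') (Q + a * Q' + Q') (d' - e) ∧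
      e = cfX ℓ (2 * (j + 1) + 1) * (d' - e) ∧ 1 / 3 < (Q + a * Q') * e := by
  have ha1 : 1 ≤ a := by
    rw [ha]
    exact_mod_cast hpos (2 * j + 1) (by omega)
  obtain ⟨hpos', hrec⟩ := cfX_odd_step hirr heven j h.error_pos
  rw [← ha, ← he] at hpos' hrec
  have hQ' := h.pos
  have hQ := h.nonneg
  have haQ : Q' ≤ a * Q' := le_mul_of_one_le_left hQ'.le ha1
  have hdet : (Q + a * Q') * (d' - e) + (Q + a * Q' + Q') * e = 1 := by
    rw [← h.det, he]
    ring
  have hlt : d' - e < e := by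
    nth_rewrite 2 [hrec]
    exact lt_mul_of_one_lt_left hpos' (one_lt_cfX_succ hirr _)
  refine ⟨⟨by linarith, by linarith, hpos', ?_⟩, hrec, ?_⟩
  · rw [← hrec, hdet]
  · exact third_lt_mul_of_le_two_mul (by linarith) hpos' hlt (by linarith) hdet

theorem IsOddState.third_lt {ℓ : ℝ} (hirr : Irrational ℓ) (hpos : ∀ k : ℕ, 1 ≤ k → 0 < cfA ℓ k)
    (heven : ∀ k : ℕ, cfA ℓ (2 * k) = 1) (N : ℕ) : ∀ {j : ℕ} {Q Q' d' : ℝ} {u w : ℤ},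
    IsOddState ℓ j Q Q' d' → u ≤ N → (w : ℝ) < u * cfX ℓ (2 * j + 1) →
    (w ≤ cfA ℓ (2 * j + 1) * u →
      1 / 3 < (u * Q + w * Q') * (u * (cfX ℓ (2 * j + 1) * d') - w * d')) →
    1 ≤ u → 1 / 3 < (u * Q + w * Q') * (u * (cfX ℓ (2 * j + 1) * d') - w * d') := by
  induction N with
  | zero =>
    intro j Q Q' d' u w _ hu _ _ hu1
    simp only [Nat.cast_zero] at hu
    omega
  | succ N ih =>
    intro j Q Q' d' u w h hu hw hsmall hu1
    by_cases hwa : w ≤ cfA ℓ (2 * j + 1) * u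
    · exact hsmall hwa
    obtain ⟨a, ha⟩ : ∃ a : ℝ, a = cfA ℓ (2 * j + 1) := ⟨_, rfl⟩
    obtain ⟨e, he⟩ : ∃ e : ℝ, e = cfX ℓ (2 * j + 1) * d' - a * d' := ⟨_, rfl⟩
    obtain ⟨h1, hrec, hend⟩ := h.next hirr hpos heven ha he
    obtain ⟨-, -, hend'⟩ := h1.next hirr hpos heven rfl rfl
    rw [← hrec] at hend'
    obtain ⟨w', hw'⟩ : ∃ w' : ℤ, w' = w - cfA ℓ (2 * j + 1) * u := ⟨_, rfl⟩
    have hw'R : (w' : ℝ) = w - a * u := by rw [hw', ha]; push_cast; rfl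
    have hw'1 : 1 ≤ w' := by omega
    have hu0 : (0 : ℝ) < u := by exact_mod_cast hu1
    have hlt : cfX ℓ (2 * j + 1) < a + 1 := by
      rw [ha]
      exact Int.lt_floor_add_one _
    have hw'u : w' < u := by
      have : (w' : ℝ) < u := by
        rw [hw'R]
        nlinarith [mul_lt_mul_of_pos_left hlt hu0]
      exact_mod_cast this
    have herr : (u : ℝ) * (cfX ℓ (2 * j + 1) * d') - w * d' =
        ((u - w' : ℤ) : ℝ) * e - w' * (d' - e) := by
      push_cast
      rw [hw'R, he]
      ring
    have hden : u * Q + w * Q' = ((u - w' : ℤ) : ℝ) * (Q + a * Q') + w' * (Q + a * Q' + Q') := by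
      push_cast
      rw [hw'R]
      ring
    have herr_pos : 0 < (u : ℝ) * (cfX ℓ (2 * j + 1) * d') - w * d' := by
      have := mul_lt_mul_of_pos_right hw h.error_pos
      linarith
    rw [hden, herr]
    rw [herr] at herr_pos
    have := ih (u := u - w') (w := w') h1 (by push_cast at hu; omega) ?_ ?_ (by omega)
    · rwa [← hrec] at this
    · refine lt_of_mul_lt_mul_right ?_ h1.error_pos.le
      rw [mul_assoc, ← hrec]
      linarith
    · intro hle
      rw [← hrec]
      refine third_lt_of_endpoints h1.pos h1.error_pos
        (a := cfA ℓ (2 * (j + 1) + 1)) ?_ ?_ ?_ ?_ hend hend'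
      · exact_mod_cast hpos (2 * (j + 1) + 1) (by omega)
      · exact_mod_cast (show 1 ≤ u - w' by omega)
      · exact_mod_cast (show 0 ≤ w' by omega)
      · exact_mod_cast hle

/-- Approximations of `ℓ` from above are bad. -/
theorem third_lt_mul_sub {ℓ : ℝ} (hirr : Irrational ℓ) (hpos : ∀ k : ℕ, 1 ≤ k → 0 < cfA ℓ k)
    (heven : ∀ k : ℕ, cfA ℓ (2 * k) = 1) (p : ℤ) {n : ℕ} (hn : 0 < n) (hlt : n * ℓ < p) :
    1 / 3 < n * (p - n * ℓ) := by
  have hℓ : 1 < ℓ := one_lt_of_cfA_zero hirr (by simpa using heven 0)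
  have hd : 0 < ℓ - 1 := sub_pos.2 hℓ
  have hy : cfX ℓ (2 * 0 + 1) * (ℓ - 1) = 1 := by
    have h : cfX ℓ 0 = _ := cfX_eq 0
    have h0 : cfA ℓ 0 = 1 := by simpa using heven 0
    have h1 := zero_lt_one.trans (one_lt_cfX_succ hirr 0)
    rw [h0, cfX] at h
    have h' : ℓ - 1 = (cfX ℓ (0 + 1))⁻¹ := by
      push_cast at h
      linarith
    rw [h']
    exact mul_inv_cancel₀ h1.ne'
  have hst : IsOddState ℓ 0 0 1 (ℓ - 1) := ⟨le_rfl, one_pos, hd, by rw [hy]; ring⟩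
  have hnR : (1 : ℝ) ≤ n := by exact_mod_cast hn
  have hu : 1 ≤ p - n := by
    have : (n : ℝ) < p := by nlinarith
    have : (n : ℤ) < p := by exact_mod_cast this
    omega
  have huR : (1 : ℝ) ≤ ((p - n : ℤ) : ℝ) := by exact_mod_cast hu
  have key := hst.third_lt hirr hpos heven (p - n).toNat (u := p - n) (w := n)
    (Int.self_le_toNat _) ?_ ?_ hu
  · rw [hy] at key
    push_cast at key
    linarith
  · refine lt_of_mul_lt_mul_right ?_ hd.le
    rw [mul_assoc, hy]
    push_cast
    linarith
  · intro hle
    obtain ⟨-, -, hend⟩ := hst.next hirr hpos heven rfl rfl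
    have hepos : (0 : ℝ) < 1 - cfA ℓ (2 * 0 + 1) * (ℓ - 1) := by
      have ha : (0 : ℝ) < cfA ℓ (2 * 0 + 1) := by exact_mod_cast hpos (2 * 0 + 1) (by omega)
      rw [hy] at hend
      nlinarith
    rw [hy] at hend ⊢
    have hapos := hpos (2 * 0 + 1) (by omega)
    generalize cfA ℓ (2 * 0 + 1) = a at *
    generalize p - (n : ℤ) = u at *
    generalize ℓ - 1 = d at *
    have haR : (1 : ℝ) ≤ a := by exact_mod_cast hapos
    have hleR : (n : ℝ) ≤ a * u := by exact_mod_cast hle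
    have hfu : 1 / 3 < (a * u : ℝ) * (u - a * u * d) := by
      have hu2 : (1 : ℝ) ≤ u ^ 2 := by nlinarith
      have : (a * u : ℝ) * (u - a * u * d) = u ^ 2 * ((0 + a * 1) * (1 - a * d)) := by ring
      rw [this]
      nlinarith [mul_le_mul_of_nonneg_right hu2 (by linarith : 0 ≤ (0 + a * 1) * (1 - a * d))]
    rcases hle.eq_or_lt with heq | hlt'
    · have : (n : ℝ) = a * u := by exact_mod_cast heq
      simp only [Int.cast_natCast, this]
      linarith
    · have hau : (2 : ℝ) ≤ a * u := by
        exact_mod_cast (show 2 ≤ a * u by omega)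
      have hf1 : 1 / 3 < (u : ℝ) - d := by
        by_cases h2 : 2 ≤ u
        · have : (2 : ℝ) ≤ u := by exact_mod_cast h2
          nlinarith
        · have h1 : u = 1 := by omega
          rw [h1] at hau ⊢
          push_cast at hau ⊢
          nlinarith
      have hconc : (a * u - 1 : ℝ) * (n * (u - n * d)) =
          (a * u - n) * (u - d) + (n - 1) * ((a * u) * (u - a * u * d))
            + (a * u - 1) * ((n - 1) * (a * u - n) * d) := by
        ring
      have hlt'R : (n : ℝ) < a * u := by exact_mod_cast hlt'
      have hfn : 1 / 3 < (n : ℝ) * (u - n * d) := by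
        have hpos1 : (0 : ℝ) < a * u - 1 := by linarith
        refine lt_of_mul_lt_mul_left ?_ hpos1.le
        rw [hconc]
        have : 0 ≤ (a * u - 1 : ℝ) * ((n - 1) * (a * u - n) * d) :=
          mul_nonneg hpos1.le (mul_nonneg (mul_nonneg (by linarith) (by linarith)) hd.le)
        nlinarith [mul_lt_mul_of_pos_left hf1 (sub_pos.2 hlt'R),
          mul_le_mul_of_nonneg_left hfu.le (sub_nonneg.2 hnR)]
      simp only [Int.cast_natCast]
      linarith

theorem stmt4 (ℓ : ℝ) (hirr : Irrational ℓ)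
    (hpos : ∀ k : ℕ, 1 ≤ k → 0 < cfA ℓ k) (h0 : 0 < cfA ℓ 0)
    (heven : ∀ k : ℕ, cfA ℓ (2 * k) = 1)
    (θ : ℝ) (hθ : θ = Real.exp (2 / ℓ)) :
    Atheta θ = ∅ ∧
    ∀ n : ℕ, 0 < n →
      ⌊(θ ^ ((n : ℝ))⁻¹ - 1)⁻¹⌋ = ⌊(n : ℝ) / Real.log θ - 1 / 2⌋ := by
  have hmain (n : ℕ) (hn : 0 < n) :
      ⌊(θ ^ ((n : ℝ))⁻¹ - 1)⁻¹⌋ = ⌊(n : ℝ) / Real.log θ - 1 / 2⌋ := by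
    have hℓ : 1 < ℓ := one_lt_of_cfA_zero hirr (by simpa using heven 0)
    have hn' : (0 : ℝ) < n := Nat.cast_pos.2 hn
    have hℓ0 : 0 < ℓ := zero_lt_one.trans hℓ
    have hx : 0 < 2 / (n * ℓ) := by positivity
    have hpow : θ ^ ((n : ℝ))⁻¹ = Real.exp (2 / (n * ℓ)) := by
      rw [hθ, ← Real.exp_mul]
      congr 1
      field_simp
    have hlog : (n : ℝ) / Real.log θ - 1 / 2 = 1 / (2 / (n * ℓ)) - 1 / 2 := by
      rw [hθ, Real.log_exp]
      field_simp
    rw [hpow, hlog]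
    have hlow := Real.le_inv_exp_sub_one hx
    have hup := Real.inv_exp_sub_one_le hx
    refine le_antisymm ?_ (Int.floor_le_floor hlow)
    by_contra! hlt
    set m := ⌊(Real.exp (2 / (n * ℓ)) - 1)⁻¹⌋
    have hm1 : 1 / (2 / (n * ℓ)) - 1 / 2 < m := Int.floor_lt.1 hlt
    have hm2 : (m : ℝ) ≤ 1 / (2 / (n * ℓ)) - 1 / 2 + 2 / (n * ℓ) / 12 := (Int.floor_le _).trans hup
    have hinv : 1 / (2 / (n * ℓ)) = n * ℓ / 2 := one_div_div _ _
    rw [hinv] at hm1 hm2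
    have h3 := third_lt_mul_sub hirr hpos heven (2 * m + 1) hn (by push_cast; linarith)
    have h4 : (n : ℝ) * (((2 * m + 1 : ℤ) : ℝ) - n * ℓ) ≤ n * (2 * (2 / (n * ℓ) / 12)) := by
      refine mul_le_mul_of_nonneg_left ?_ hn'.le
      push_cast
      linarith
    have h5 : (n : ℝ) * (2 * (2 / (n * ℓ) / 12)) = 1 / (3 * ℓ) := by
      field_simp
      norm_num
    have h6 : 1 / (3 * ℓ) ≤ 1 / 3 := one_div_le_one_div_of_le (by norm_num) (by linarith)
    linarith
  refine ⟨Set.eq_empty_iff_forall_notMem.2 fun n hn => hn.2 (hmain n hn.1), hmain⟩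
end

section
/- Let c be a positive integer and let θ = e^{4 − c + √(c(c+1))}. Then A_θ is infinite. -/
/-- The equation `c q² - 4 c k q - 4 k² = c` has solutions with `q = 2 m + 1` odd and arbitrarily
large; it is the Pell-type equation `c (c + 1) q² - P² = c` with `P = c q + 2 k`. -/
theorem exists_large_odd_pell_solution (c : ℕ) (hc : 0 < c) (N : ℕ) :
    ∃ m k : ℕ, N ≤ m ∧
      (c : ℤ) * (2 * m + 1) ^ 2 - 4 * c * k * (2 * m + 1) - 4 * k ^ 2 = c := by
  induction N with
  | zero => exact ⟨0, 0, le_rfl, by simp⟩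
  | succ N ih =>
    obtain ⟨m, k, hm, h⟩ := ih
    refine ⟨(4 * c + 1) * m + 2 * c + 2 * k, c * (2 * m + 1) + k, ?_, ?_⟩
    · nlinarith [Nat.zero_le (c * m)]
    · push_cast
      linear_combination h

/-- The first two terms of the series of `log ((q + 1) / (q - 1))` bound it from below. -/
theorem two_mul_inv_add_le_log {q : ℝ} (hq : 1 < q) :
    2 * (1 / q + 1 / (3 * q ^ 3)) ≤ Real.log ((q + 1) / (q - 1)) := by
  have hq0 : 0 < q := by linarith
  have h := Real.sum_range_le_log_div (x := 1 / q) (by positivity)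
    ((div_lt_one hq0).2 hq) 2
  have he : (1 + 1 / q) / (1 - 1 / q) = (q + 1) / (q - 1) := by
    have : q - 1 ≠ 0 := by linarith
    field_simp
  rw [he] at h
  norm_num [Finset.sum_range_succ] at h
  have hs : 1 / q + 1 / (3 * q ^ 3) = q⁻¹ + (q ^ 3)⁻¹ / 3 := by
    field_simp
  rw [hs]
  linarith

/-- If `2 n / q` is a sufficiently good lower approximation of `log θ` with `q = 2 m + 1`,
then `n` is atypical. -/
theorem mem_Atheta_of_approx {L : ℝ} {n m : ℕ} (hL : 0 < L) (hn : 0 < n) (hm : 0 < m)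
    (hlt : 2 * (n : ℝ) < (2 * m + 1) * L)
    (hle : (3 * (2 * (m : ℝ) + 1) ^ 2 + 1) * ((2 * m + 1) * L - 2 * n) ≤ (2 * m + 1) * L) :
    n ∈ Atheta (Real.exp L) := by
  have hn' : (0 : ℝ) < n := by exact_mod_cast hn
  have hm' : (0 : ℝ) < m := by exact_mod_cast hm
  refine ⟨hn, ne_of_gt ?_⟩
  have h₁ : ⌊(n : ℝ) / Real.log (Real.exp L) - 1 / 2⌋ < (m : ℤ) := by
    rw [Int.floor_lt, Real.log_exp, sub_lt_iff_lt_add, div_lt_iff₀ hL]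
    push_cast
    linarith
  refine h₁.trans_le ?_
  rw [Int.le_floor, ← Real.exp_mul, ← div_eq_mul_inv]
  have hq : 1 < 2 * (m : ℝ) + 1 := by linarith
  have hy : L / n ≤ Real.log ((2 * m + 1 + 1) / (2 * m + 1 - 1)) := by
    refine le_trans ?_ (two_mul_inv_add_le_log hq)
    generalize 2 * (m : ℝ) + 1 = q at *
    have hq0 : 0 < q := by linarith
    rw [show 2 * (1 / q + 1 / (3 * q ^ 3)) = 2 * (3 * q ^ 2 + 1) / (3 * q ^ 3) by
      field_simp, div_le_div_iff₀ hn' (by positivity)]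
    linarith
  have hexp := (Real.le_log_iff_exp_le (div_pos (by linarith) (by linarith))).1 hy
  have hpos : 0 < Real.exp (L / n) - 1 := by
    have := Real.add_one_le_exp (L / n)
    have : 0 < L / n := by positivity
    linarith
  rw [show (2 * (m : ℝ) + 1 + 1) / (2 * m + 1 - 1) = 1 + (m : ℝ)⁻¹ by field_simp; ring] at hexp
  push_cast
  rw [le_inv_comm₀ hm' hpos]
  linarith

theorem stmt7 (c : ℕ) (hc : 0 < c) (θ : ℝ)
    (hθ : θ = Real.exp (4 - (c : ℝ) + Real.sqrt ((c : ℝ) * (c + 1)))) :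
    (Atheta θ).Infinite := by
  subst hθ
  refine Set.infinite_of_forall_exists_gt fun N => ?_
  obtain ⟨m, k, hm, h⟩ := exists_large_odd_pell_solution c hc (N + 1)
  have h' : (c : ℝ) * (2 * m + 1) ^ 2 - 4 * c * k * (2 * m + 1) - 4 * k ^ 2 = c := by
    exact_mod_cast h
  have hc' : (0 : ℝ) < c := by exact_mod_cast hc
  have hs2 : Real.sqrt ((c : ℝ) * (c + 1)) ^ 2 = c * (c + 1) := Real.sq_sqrt (by positivity)
  have hsc : (c : ℝ) ≤ Real.sqrt ((c : ℝ) * (c + 1)) := Real.le_sqrt_of_sq_le (by nlinarith)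
  generalize Real.sqrt ((c : ℝ) * (c + 1)) = s at *
  have hm0 : (0 : ℝ) ≤ m := m.cast_nonneg
  have hk0 : (0 : ℝ) ≤ k := k.cast_nonneg
  refine ⟨4 * m + 2 + k, mem_Atheta_of_approx (m := m) (by linarith) (by omega) (by omega) ?_ ?_,
    by omega⟩ <;> push_cast <;> generalize hqm : 2 * (m : ℝ) + 1 = q at *
  all_goals
    have hq : 1 ≤ q := by linarith
    have hprod : (q * s - (c * q + 2 * k)) * (q * s + (c * q + 2 * k)) = c := by
      linear_combination h' + q ^ 2 * hs2
    have hcq : 0 < c * q := by positivity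
    have hsq : c * q ≤ q * s := by nlinarith
    have hpos : 0 < q * s - (c * q + 2 * k) :=
      pos_of_mul_pos_left (hprod ▸ hc') (by linarith)
  · linarith
  · rw [show q * (4 - c + s) - 2 * (4 * m + 2 + k) = q * s - (c * q + 2 * k) by
      linear_combination (-4) * hqm]
    generalize q * s - (c * q + 2 * k) = ε at *
    have hε : 2 * q * ε ≤ 1 := by
      refine le_of_mul_le_mul_left ?_ hc'
      nlinarith
    nlinarith
end

section
/- The function f(t) = 1/(e^t − 1) − 1/t + 1/2 is strictly increasing on (0, ∞), f(t) → 0 as t → 0⁺, and f(t) → 1/2 as t → ∞. -/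
/-- `f(t) = 1/(e^t - 1) - 1/t + 1/2`. -/
noncomputable def f (t : ℝ) : ℝ := (Real.exp t - 1)⁻¹ - t⁻¹ + 1 / 2

theorem exp_sub_one_pos {t : ℝ} (ht : 0 < t) : 0 < Real.exp t - 1 :=
  sub_pos.mpr (Real.one_lt_exp_iff.mpr ht)

theorem hasDerivAt_f {t : ℝ} (ht : 0 < t) :
    HasDerivAt f (-Real.exp t / (Real.exp t - 1) ^ 2 - -1 / t ^ 2) t := by
  have h₁ := ((Real.hasDerivAt_exp t).sub_const 1).fun_inv (exp_sub_one_pos ht).ne'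
  have h₂ := (hasDerivAt_id' t).fun_inv ht.ne'
  exact (h₁.sub h₂).add_const (1 / 2)

theorem sq_mul_exp_lt_sq_exp_sub_one {t : ℝ} (ht : 0 < t) :
    t ^ 2 * Real.exp t < (Real.exp t - 1) ^ 2 := by
  have hs : t / 2 < Real.sinh (t / 2) := Real.self_lt_sinh_iff.mpr (by linarith)
  rw [Real.sinh_eq, Real.exp_neg] at hs
  have ha : 0 < Real.exp (t / 2) := Real.exp_pos _
  have hsq : Real.exp t = Real.exp (t / 2) ^ 2 := by
    rw [← Real.exp_nat_mul]; congr 1; push_cast; ring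
  have hlt : t * Real.exp (t / 2) < Real.exp (t / 2) ^ 2 - 1 := by
    have h := mul_lt_mul_of_pos_right hs ha
    have hi : (Real.exp (t / 2))⁻¹ * Real.exp (t / 2) = 1 := inv_mul_cancel₀ ha.ne'
    linarith
  rw [hsq, ← mul_pow]
  exact pow_lt_pow_left₀ hlt (by positivity) two_ne_zero

theorem strictMonoOn_f : StrictMonoOn f (Set.Ioi (0 : ℝ)) := by
  refine strictMonoOn_of_deriv_pos (convex_Ioi 0)
    (fun t ht => (hasDerivAt_f ht).continuousAt.continuousWithinAt) fun t ht => ?_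
  rw [interior_Ioi, Set.mem_Ioi] at ht
  have h : Real.exp t / (Real.exp t - 1) ^ 2 < 1 / t ^ 2 := by
    rw [div_lt_div_iff₀ (pow_pos (exp_sub_one_pos ht) 2) (by positivity)]
    linarith [sq_mul_exp_lt_sq_exp_sub_one ht]
  rw [(hasDerivAt_f ht).deriv, neg_div, neg_div]
  linarith

theorem abs_f_le {t : ℝ} (ht : 0 < t) (ht1 : t ≤ 1) : |f t| ≤ t := by
  have hb := Real.exp_bound (abs_le.mpr ⟨by linarith, ht1⟩) (show 0 < 3 by norm_num)
  norm_num [Finset.sum_range_succ, Nat.factorial, abs_of_pos ht] at hb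
  have hE := exp_sub_one_pos ht
  have htE : t ≤ Real.exp t - 1 := by linarith [Real.add_one_le_exp t]
  have hf : f t = (t * (Real.exp t - 1) - 2 * (Real.exp t - 1) + 2 * t) /
      (2 * t * (Real.exp t - 1)) := by
    have := hE.ne'
    unfold f
    field_simp
    ring
  have ht3 : 0 < t ^ 3 := by positivity
  have hden : 2 * t ^ 3 ≤ t * (2 * t * (Real.exp t - 1)) := by
    nlinarith [mul_le_mul_of_nonneg_left htE (sq_nonneg t)]
  rw [hf, abs_div, abs_of_pos (show 0 < 2 * t * (Real.exp t - 1) by positivity),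
    div_le_iff₀ (by positivity)]
  refine le_trans ?_ hden
  obtain ⟨r, hr⟩ : ∃ r, Real.exp t = 1 + t + t ^ 2 / 2 + r :=
    ⟨Real.exp t - (1 + t + t ^ 2 / 2), by ring⟩
  rw [hr] at hb ⊢
  rw [add_sub_cancel_left] at hb
  calc |t * (1 + t + t ^ 2 / 2 + r - 1) - 2 * (1 + t + t ^ 2 / 2 + r - 1) + 2 * t|
      = |t ^ 3 / 2 + (t - 2) * r| := by congr 1; ring
    _ ≤ |t ^ 3 / 2| + |t - 2| * |r| := by rw [← abs_mul]; exact abs_add_le _ _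
    _ ≤ t ^ 3 / 2 + 2 * (t ^ 3 * (2 / 9)) := by
      rw [abs_of_pos (by positivity : 0 < t ^ 3 / 2)]
      gcongr
      exact abs_le.mpr ⟨by linarith, by linarith⟩
    _ ≤ 2 * t ^ 3 := by linarith

theorem tendsto_f_zero : Filter.Tendsto f (nhdsWithin 0 (Set.Ioi 0)) (nhds 0) := by
  refine squeeze_zero_norm' (a := fun t => t) ?_
    (tendsto_nhdsWithin_of_tendsto_nhds Filter.tendsto_id)
  filter_upwards [Ioc_mem_nhdsGT (zero_lt_one' ℝ)] with t ht
  exact abs_f_le ht.1 ht.2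

theorem tendsto_f_atTop : Filter.Tendsto f Filter.atTop (nhds (1 / 2)) := by
  have h : Filter.Tendsto (fun t => Real.exp t - 1) Filter.atTop Filter.atTop :=
    Filter.tendsto_atTop_add_const_right _ (-1) Real.tendsto_exp_atTop
  simpa [show f = fun t => (Real.exp t - 1)⁻¹ - t⁻¹ + 1 / 2 from rfl] using
    (h.inv_tendsto_atTop.sub tendsto_inv_atTop_zero).add_const (1 / 2 : ℝ)

theorem stmt8 :
    StrictMonoOn f (Set.Ioi (0 : ℝ)) ∧
    Filter.Tendsto f (nhdsWithin 0 (Set.Ioi 0)) (nhds 0) ∧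
    Filter.Tendsto f Filter.atTop (nhds (1 / 2)) :=
  ⟨strictMonoOn_f, tendsto_f_zero, tendsto_f_atTop⟩
end

section
/- For every real t with 0 < t < 1, the function f(t) = 1/(e^t − 1) − 1/t + 1/2 satisfies t/12 − t³/720 < f(t) < t/12. -/
theorem stmt9 (t : ℝ) (h0 : 0 < t) (h1 : t < 1) :
    t / 12 - t ^ 3 / 720 < f t ∧ f t < t / 12 := by
  have hlow := Real.sum_le_exp_of_nonneg h0.le 6
  have hupp := Real.exp_bound' h0.le h1.le (n := 8) (by norm_num)
  simp only [Finset.sum_range_succ, Finset.sum_range_zero, Nat.factorial] at hlow hupp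
  norm_num at hlow hupp
  have hE : 0 < Real.exp t - 1 := by linarith [Real.add_one_le_exp t]
  unfold f
  generalize Real.exp t = e at *
  constructor
  · have hP : 0 < 720 - 360 * t + 60 * t ^ 2 - t ^ 4 := by
      nlinarith [pow_le_one₀ h0.le h1.le (n := 4), sq_nonneg t]
    have key : (e - 1) * (720 - 360 * t + 60 * t ^ 2 - t ^ 4) < 720 * t := by
      refine (mul_le_mul_of_nonneg_right (sub_le_sub_right hupp 1) hP.le).trans_lt ?_
      have h7 : 0 < t ^ 7 := by positivity
      have h11' : 0 < t ^ 11 := by positivity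
      nlinarith
    have := (div_lt_div_iff₀ (by positivity : 0 < 720 * t) hE).2
      (by linarith : (720 - 360 * t + 60 * t ^ 2 - t ^ 4) * (e - 1) < 1 * (720 * t))
    have heq : (720 - 360 * t + 60 * t ^ 2 - t ^ 4) / (720 * t)
        = t⁻¹ - 1 / 2 + t / 12 - t ^ 3 / 720 := by
      field_simp
      ring
    rw [heq, one_div (e - 1)] at this
    linarith
  · have hP : 0 < 12 - 6 * t + t ^ 2 := by nlinarith [sq_nonneg t]
    have key : 12 * t < (e - 1) * (12 - 6 * t + t ^ 2) := by
      refine lt_of_lt_of_le ?_ (mul_le_mul_of_nonneg_right (sub_le_sub_right hlow 1) hP.le)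
      have h6 : t ^ 6 ≤ t ^ 5 := pow_le_pow_of_le_one h0.le h1.le (by norm_num)
      have h5 : 0 < t ^ 5 := by positivity
      have h7 : 0 < t ^ 7 := by positivity
      nlinarith
    have := (div_lt_div_iff₀ hE (by positivity : 0 < 12 * t)).2
      (by linarith : 1 * (12 * t) < (12 - 6 * t + t ^ 2) * (e - 1))
    have heq : (12 - 6 * t + t ^ 2) / (12 * t) = t⁻¹ - 1 / 2 + t / 12 := by
      field_simp
      ring
    rw [heq, one_div (e - 1)] at this
    linarith
end

section
/- Let θ > 1 be real and n a positive integer. Then M'_θ(n) equals either ⌊n/log θ − 1/2⌋ or ⌊n/log θ + 1/2⌋; moreover M'_θ(n) = ⌊n/log θ + 1/2⌋ if and only if 1/2 − f(log θ / n) ≤ {n/log θ} < 1/2, where {·} denotes the fractional part. -/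
/-- `M'_θ(n) = ⌊1/(θ^{1/n} - 1)⌋`. -/
noncomputable def Mtheta' (θ : ℝ) (n : ℕ) : ℤ := ⌊(θ ^ ((n : ℝ))⁻¹ - 1)⁻¹⌋

theorem f_nonneg {t : ℝ} (ht : 0 < t) : 0 ≤ f t := by
  have hu : 0 < Real.exp t - 1 := by linarith [Real.add_one_lt_exp ht.ne']
  have h := Real.le_log_one_add_of_nonneg hu.le
  rw [add_sub_cancel, Real.log_exp] at h
  have h' : t⁻¹ ≤ (2 * (Real.exp t - 1) / (Real.exp t - 1 + 2))⁻¹ :=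
    inv_anti₀ (by positivity) h
  have h_inv : (2 * (Real.exp t - 1) / (Real.exp t - 1 + 2))⁻¹ =
      (Real.exp t - 1)⁻¹ + 1 / 2 := by
    field_simp
    ring
  unfold f
  linarith

theorem f_lt_half {t : ℝ} (ht : 0 < t) : f t < 1 / 2 := by
  have h : (Real.exp t - 1)⁻¹ < t⁻¹ :=
    inv_strictAnti₀ ht (by linarith [Real.add_one_lt_exp ht.ne'])
  unfold f
  linarith

theorem Mtheta'_eq_floor_add_f {θ : ℝ} (hθ : 1 < θ) (n : ℕ) :
    Mtheta' θ n = ⌊(n : ℝ) / Real.log θ - 1 / 2 + f (Real.log θ / n)⌋ := by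
  unfold Mtheta' f
  rw [Real.rpow_def_of_pos (by linarith), ← div_eq_mul_inv, inv_div]
  congr 1
  ring

theorem floor_sub_half_add_eq_or (x : ℝ) {y : ℝ} (hy₀ : 0 ≤ y) (hy : y < 1 / 2) :
    ⌊x - 1 / 2 + y⌋ = ⌊x - 1 / 2⌋ ∨ ⌊x - 1 / 2 + y⌋ = ⌊x + 1 / 2⌋ := by
  have h_lower : ⌊x - 1 / 2⌋ ≤ ⌊x - 1 / 2 + y⌋ := Int.floor_mono (by linarith)
  have h_upper : ⌊x - 1 / 2 + y⌋ ≤ ⌊x + 1 / 2⌋ := Int.floor_mono (by linarith)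
  have h_succ : ⌊x + 1 / 2⌋ = ⌊x - 1 / 2⌋ + 1 := by
    rw [← Int.floor_add_one]
    congr 1
    ring
  omega

theorem floor_sub_half_add_eq_iff (x : ℝ) {y : ℝ} (hy : y < 1 / 2) :
    ⌊x - 1 / 2 + y⌋ = ⌊x + 1 / 2⌋ ↔ 1 / 2 - y ≤ Int.fract x ∧ Int.fract x < 1 / 2 := by
  have hx := Int.floor_add_fract x
  have h₀ := Int.fract_nonneg x
  have h₁ := Int.fract_lt_one x
  rcases lt_or_ge (Int.fract x) (1 / 2) with h | h
  · have h_floor : ⌊x + 1 / 2⌋ = ⌊x⌋ := by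
      rw [Int.floor_eq_iff]
      constructor <;> linarith
    rw [h_floor, Int.floor_eq_iff]
    constructor
    · rintro ⟨h_le, -⟩
      exact ⟨by linarith, h⟩
    · rintro ⟨h_le, -⟩
      constructor <;> linarith
  · have h_floor : ⌊x + 1 / 2⌋ = ⌊x⌋ + 1 := by
      rw [Int.floor_eq_iff]
      push_cast
      constructor <;> linarith
    rw [h_floor, Int.floor_eq_iff]
    push_cast
    constructor
    · rintro ⟨h_le, -⟩
      linarith
    · rintro ⟨-, h_lt⟩
      linarith

theorem stmt10 (θ : ℝ) (hθ : 1 < θ) (n : ℕ) (hn : 0 < n) :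
    (Mtheta' θ n = ⌊(n : ℝ) / Real.log θ - 1 / 2⌋ ∨
      Mtheta' θ n = ⌊(n : ℝ) / Real.log θ + 1 / 2⌋) ∧
    (Mtheta' θ n = ⌊(n : ℝ) / Real.log θ + 1 / 2⌋ ↔
      (1 / 2 - f (Real.log θ / n) ≤ Int.fract ((n : ℝ) / Real.log θ) ∧
        Int.fract ((n : ℝ) / Real.log θ) < 1 / 2)) := by
  have ht : 0 < Real.log θ / n := div_pos (Real.log_pos hθ) (by exact_mod_cast hn)
  rw [Mtheta'_eq_floor_add_f hθ]
  exact ⟨floor_sub_half_add_eq_or _ (f_nonneg ht) (f_lt_half ht),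
    floor_sub_half_add_eq_iff _ (f_lt_half ht)⟩
end
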